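/- arXiv:1002.0030 — 3 statements merged into one kernel-verified Lean document; each statement's English description precedes it below -/
import Mathlib

section
/- Let M be a compact topological space and R₀ : M → ℝ continuous with R₀(x) ≠ 0 for all x. Let (λ_j)_{j≥1} be a nondecreasing sequence of positive reals with λ_j → ∞ and with λ₁ = λ₂ = ⋯ = λ_m < λ_{m+1} for some m ≥ 1, and let φ_j : M → ℝ be continuous functions such that ∑_{j≥1} e^{−λ_j t}·(sup_{x∈M} φ_j(x)²) < ∞ for every t > 0. Define σ_v²(T) := sup_{x∈M} ( ∑_{j≥1} e^{−λ_j T} φ_j(x)² ) / R₀(x)² and F := sup_{x∈M} ( ∑_{j=1}^m φ_j(x)² ) / R₀(x)², and assume F > 0. Then lim_{T→∞} σ_v²(T) / ( F·e^{−λ₁ T} ) = 1. -/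
open Real Filter Set

/-- Splitting off the first `m` terms of `∑ e^{-λ_j T} a_j`, where `λ` is constant, bounds the sum
from both sides by the leading block, with an error of order `e^{-λ_m (T - 1)}`. -/
lemma exp_sum_leading_block_bounds (lam : ℕ → ℝ) (hmono : Monotone lam) (m : ℕ)
    (hmult : ∀ j < m, lam j = lam 0) (a b : ℕ → ℝ) (ha : ∀ j, 0 ≤ a j) (hab : ∀ j, a j ≤ b j)
    (hsum : ∀ t : ℝ, 0 < t → Summable fun j : ℕ => Real.exp (-lam j * t) * b j)
    {T : ℝ} (hT : 1 ≤ T) :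
    Real.exp (-lam 0 * T) * ∑ j ∈ Finset.range m, a j ≤ ∑' j, Real.exp (-lam j * T) * a j ∧
    ∑' j, Real.exp (-lam j * T) * a j ≤ Real.exp (-lam 0 * T) * ∑ j ∈ Finset.range m, a j +
      Real.exp (-lam m * (T - 1)) * ∑' j, Real.exp (-lam j * 1) * b j := by
  have hb : ∀ j, 0 ≤ b j := fun j => (ha j).trans (hab j)
  have hs : Summable fun j => Real.exp (-lam j * T) * a j :=
    Summable.of_nonneg_of_le (fun j => mul_nonneg (Real.exp_pos _).le (ha j))
      (fun j => mul_le_mul_of_nonneg_left (hab j) (Real.exp_pos _).le)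
      (hsum T (by linarith))
  have hblock : ∑ j ∈ Finset.range m, Real.exp (-lam j * T) * a j =
      Real.exp (-lam 0 * T) * ∑ j ∈ Finset.range m, a j := by
    rw [Finset.mul_sum]
    exact Finset.sum_congr rfl fun j hj => by rw [hmult j (Finset.mem_range.1 hj)]
  rw [← hs.sum_add_tsum_nat_add m, hblock]
  refine ⟨le_add_of_nonneg_right
    (tsum_nonneg fun j => mul_nonneg (Real.exp_pos _).le (ha _)), ?_⟩
  gcongr
  have h1 := hsum 1 one_pos
  have h1m := (summable_nat_add_iff m).2 h1
  calc ∑' j, Real.exp (-lam (j + m) * T) * a (j + m)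
      ≤ ∑' j, Real.exp (-lam m * (T - 1)) * (Real.exp (-lam (j + m) * 1) * b (j + m)) := by
        refine Summable.tsum_le_tsum (fun j => ?_) ((summable_nat_add_iff m).2 hs)
          (h1m.mul_left _)
        rw [← mul_assoc, ← Real.exp_add]
        refine mul_le_mul (Real.exp_le_exp.2 ?_) (hab _) (ha _) (Real.exp_pos _).le
        nlinarith [hmono (Nat.le_add_left m j)]
    _ = Real.exp (-lam m * (T - 1)) * ∑' j, Real.exp (-lam (j + m) * 1) * b (j + m) :=
        tsum_mul_left
    _ ≤ _ := by
        refine mul_le_mul_of_nonneg_left ?_ (Real.exp_pos _).le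
        rw [← h1.sum_add_tsum_nat_add m]
        exact le_add_of_nonneg_left
          (Finset.sum_nonneg fun j _ => mul_nonneg (Real.exp_pos _).le (hb j))


/-- Paper: Proposition 3.7.  Indices are shifted so that `lam j`, `φ j` for `j : ℕ`
represent `λ_{j+1}`, `φ_{j+1}`; in particular `lam 0 = λ₁` and the multiplicity-`m`
eigenvalue block is `lam 0 = ⋯ = lam (m−1) < lam m`.  Then
`σ_v²(T) / (F e^{−λ₁ T}) → 1` as `T → ∞`. -/
theorem stmt_7 {M : Type*} [TopologicalSpace M] [CompactSpace M] [Nonempty M]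
    (R₀ : M → ℝ) (hR₀cont : Continuous R₀) (hR₀ne : ∀ x, R₀ x ≠ 0)
    (lam : ℕ → ℝ) (hpos : ∀ j, 0 < lam j) (hmono : Monotone lam)
    (hlim : Filter.Tendsto lam Filter.atTop Filter.atTop)
    (m : ℕ) (hm : 1 ≤ m)
    (hmult : ∀ j < m, lam j = lam 0) (hgap : lam 0 < lam m)
    (φ : ℕ → M → ℝ) (hφ : ∀ j, Continuous (φ j))
    (hsum : ∀ t : ℝ, 0 < t →
      Summable fun j : ℕ => Real.exp (-lam j * t) * ⨆ x : M, φ j x ^ 2)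
    (F : ℝ) (hF : F = ⨆ x : M, (∑ j ∈ Finset.range m, φ j x ^ 2) / R₀ x ^ 2)
    (hFpos : 0 < F) :
    Filter.Tendsto
      (fun T : ℝ =>
        (⨆ x : M, (∑' j : ℕ, Real.exp (-lam j * T) * φ j x ^ 2) / R₀ x ^ 2) /
          (F * Real.exp (-lam 0 * T)))
      Filter.atTop (nhds 1) := by
  have hbdd : ∀ {f : M → ℝ}, Continuous f → BddAbove (range f) := fun hf =>
    (isCompact_range hf).bddAbove
  have hR2 : ∀ x, 0 < R₀ x ^ 2 := fun x => by have := hR₀ne x; positivity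
  obtain ⟨C, hC⟩ := hbdd ((hR₀cont.pow 2).inv₀ fun x => (hR2 x).ne')
  have hC' : ∀ x, (R₀ x ^ 2)⁻¹ ≤ C := fun x => hC (mem_range_self x)
  have hC0 : 0 ≤ C := by
    obtain ⟨x⟩ := ‹Nonempty M›
    exact (inv_pos.2 (hR2 x)).le.trans (hC' x)
  set b : ℕ → ℝ := fun j => ⨆ x : M, φ j x ^ 2
  have hle : ∀ j x, φ j x ^ 2 ≤ b j := fun j x => le_ciSup (hbdd ((hφ j).pow 2)) x
  set K : ℝ := ∑' j, Real.exp (-lam j * 1) * b j with hK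
  have hK0 : 0 ≤ K := tsum_nonneg fun j => mul_nonneg (Real.exp_pos _).le
    (Real.iSup_nonneg fun x => sq_nonneg _)
  have hFb : BddAbove (range fun x : M => (∑ j ∈ Finset.range m, φ j x ^ 2) / R₀ x ^ 2) :=
    hbdd ((continuous_finsetSum _ fun j _ => (hφ j).pow 2).div (hR₀cont.pow 2)
      fun x => (hR2 x).ne')
  have hFx : ∀ x, (∑ j ∈ Finset.range m, φ j x ^ 2) / R₀ x ^ 2 ≤ F := fun x => by
    rw [hF]; exact le_ciSup hFb x
  have key : ∀ T : ℝ, 1 ≤ T →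
      F * Real.exp (-lam 0 * T) ≤
        (⨆ x : M, (∑' j : ℕ, Real.exp (-lam j * T) * φ j x ^ 2) / R₀ x ^ 2) ∧
      (⨆ x : M, (∑' j : ℕ, Real.exp (-lam j * T) * φ j x ^ 2) / R₀ x ^ 2) ≤
        F * Real.exp (-lam 0 * T) + Real.exp (-lam m * (T - 1)) * K * C := by
    intro T hT
    have hx := fun x : M => exp_sum_leading_block_bounds lam hmono m hmult
      (fun j => φ j x ^ 2) b (fun j => sq_nonneg _) (fun j => hle j x) hsum hT
    have hup : ∀ x, (∑' j : ℕ, Real.exp (-lam j * T) * φ j x ^ 2) / R₀ x ^ 2 ≤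
        F * Real.exp (-lam 0 * T) + Real.exp (-lam m * (T - 1)) * K * C := by
      intro x
      calc _ ≤ (Real.exp (-lam 0 * T) * ∑ j ∈ Finset.range m, φ j x ^ 2 +
            Real.exp (-lam m * (T - 1)) * K) / R₀ x ^ 2 :=
            div_le_div_of_nonneg_right (hx x).2 (hR2 x).le
        _ = (∑ j ∈ Finset.range m, φ j x ^ 2) / R₀ x ^ 2 * Real.exp (-lam 0 * T) +
            Real.exp (-lam m * (T - 1)) * K * (R₀ x ^ 2)⁻¹ := by ring
        _ ≤ _ := add_le_add
            (mul_le_mul_of_nonneg_right (hFx x) (Real.exp_pos _).le)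
            (mul_le_mul_of_nonneg_left (hC' x) (mul_nonneg (Real.exp_pos _).le hK0))
    refine ⟨?_, ciSup_le hup⟩
    rw [← le_div_iff₀ (Real.exp_pos _), hF]
    refine ciSup_le fun x => ?_
    rw [le_div_iff₀ (Real.exp_pos _)]
    refine le_trans ?_ (le_ciSup ⟨_, forall_mem_range.2 hup⟩ x)
    rw [div_mul_eq_mul_div, mul_comm]
    exact div_le_div_of_nonneg_right (hx x).1 (hR2 x).le
  have hexp : Tendsto (fun T : ℝ => Real.exp (-((lam m - lam 0) * T))) atTop (nhds 0) :=
    Real.tendsto_exp_neg_atTop_nhds_zero.comp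
      (tendsto_id.const_mul_atTop (sub_pos.2 hgap))
  have hlimit : Tendsto (fun T : ℝ =>
      1 + Real.exp (lam m) * K * C / F * Real.exp (-((lam m - lam 0) * T))) atTop (nhds 1) := by
    simpa using (hexp.const_mul (Real.exp (lam m) * K * C / F)).const_add 1
  refine tendsto_of_tendsto_of_tendsto_of_le_of_le' tendsto_const_nhds hlimit ?_ ?_
  · filter_upwards [eventually_ge_atTop (1 : ℝ)] with T hT
    rw [one_le_div (by positivity)]
    exact (key T hT).1
  · filter_upwards [eventually_ge_atTop (1 : ℝ)] with T hT
    rw [div_le_iff₀ (by positivity)]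
    refine (key T hT).2.trans_eq ?_
    have : Real.exp (-lam m * (T - 1)) = Real.exp (lam m) *
        Real.exp (-((lam m - lam 0) * T)) * Real.exp (-lam 0 * T) := by
      rw [← Real.exp_add, ← Real.exp_add]; congr 1; ring
    rw [this]
    field_simp
end

section
/- Let n > 2 be an integer, M a compact metric space, and R₀ : M → ℝ continuous with R₀(x) < 0 for all x. Let h : Ω × M → ℝ be a centered Gaussian process with almost surely continuous sample paths, and let B : Ω × M → ℝ be jointly measurable with B(ω,x) ≥ 0 for all ω, x. Set σ_v² := sup_{x∈M} E[h(x)²]/R₀(x)², assumed finite and positive. Then there exist constants α > 0, C and a₀ > 0 such that for all 0 < a < a₀, Prob{ ∃ x ∈ M : R₀(x) − a(n−1)·h(ω,x) − (a²(n−1)(n−2)/4)·B(ω,x) > 0 } ≤ C·exp( α/(a(n−1)) − 1/(2a²(n−1)²σ_v²) ). -/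
open MeasureTheory ProbabilityTheory Real Filter Set

/-- A real random variable is a centered Gaussian. -/
def IsCenteredGaussianRV {Ω : Type*} [MeasurableSpace Ω] (P : Measure Ω) (X : Ω → ℝ) : Prop :=
  ∃ v : NNReal, Measure.map X P = ProbabilityTheory.gaussianReal 0 v

/-- A centered Gaussian process: jointly measurable and every finite real linear
combination of its values is a centered real Gaussian random variable. -/
def IsCenteredGaussianProcess {Ω T : Type*} [MeasurableSpace Ω] [MeasurableSpace T]
    (P : Measure Ω) (f : Ω × T → ℝ) : Prop :=
  Measurable f ∧
    ∀ (k : ℕ) (c : Fin k → ℝ) (x : Fin k → T),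
      IsCenteredGaussianRV P (fun ω => ∑ i, c i * f (ω, x i))

/-- The one-dimensional Brunn–Minkowski inequality for compact sets. -/
theorem volume_add_volume_le_of_isCompact {K L S : Set ℝ} {l : ℝ} (hl0 : 0 < l) (hl1 : l < 1)
    (hK : IsCompact K) (hL : IsCompact L) (hKne : K.Nonempty) (hLne : L.Nonempty)
    (hS : ∀ x ∈ K, ∀ y ∈ L, l * x + (1 - l) * y ∈ S) :
    ENNReal.ofReal l * volume K + ENNReal.ofReal (1 - l) * volume L ≤ volume S := by
  obtain ⟨M, hMK, hM⟩ := hK.exists_isGreatest hKne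
  obtain ⟨m, hmL, hm⟩ := hL.exists_isLeast hLne
  set K' := AffineMap.homothety m l '' K with hK'
  set L' := AffineMap.homothety M (1 - l) '' L with hL'
  have hvK : volume K' = ENNReal.ofReal l * volume K := by
    rw [hK', Measure.addHaar_image_homothety]; simp [abs_of_pos hl0]
  have hvL : volume L' = ENNReal.ofReal (1 - l) * volume L := by
    rw [hL', Measure.addHaar_image_homothety]; simp [abs_of_pos (sub_pos.2 hl1)]
  have hsub : K' ∪ L' ⊆ S := by
    rintro _ (⟨x, hx, rfl⟩ | ⟨y, hy, rfl⟩)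
    · have := hS x hx m hmL
      simp only [AffineMap.homothety_apply, vsub_eq_sub, smul_eq_mul, vadd_eq_add]
      convert this using 1; ring
    · have := hS M hMK y hy
      simp only [AffineMap.homothety_apply, vsub_eq_sub, smul_eq_mul, vadd_eq_add]
      convert this using 1; ring
  have hinter : K' ∩ L' ⊆ {l * M + (1 - l) * m} := by
    rintro z ⟨⟨x, hx, hxz⟩, ⟨y, hy, hyz⟩⟩
    simp only [AffineMap.homothety_apply, vsub_eq_sub, smul_eq_mul, vadd_eq_add] at hxz hyz
    have h1 := mul_le_mul_of_nonneg_left (hM hx) hl0.le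
    have h2 := mul_le_mul_of_nonneg_left (hm hy) (sub_pos.2 hl1).le
    rw [mem_singleton_iff]
    apply le_antisymm <;> linarith
  have hdisj : AEDisjoint volume K' L' := measure_mono_null hinter (by simp)
  have hmeas : MeasurableSet L' :=
    (hL.image (AffineMap.homothety_continuous M (1 - l))).measurableSet
  rw [← hvK, ← hvL, ← measure_union₀ hmeas.nullMeasurableSet hdisj]
  exact measure_mono hsub

/-- The one-dimensional Brunn–Minkowski inequality for measurable sets. -/
theorem volume_add_volume_le {A B S : Set ℝ} {l : ℝ} (hl0 : 0 < l) (hl1 : l < 1)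
    (hA : MeasurableSet A) (hB : MeasurableSet B) (hAne : A.Nonempty) (hBne : B.Nonempty)
    (hS : ∀ x ∈ A, ∀ y ∈ B, l * x + (1 - l) * y ∈ S) :
    ENNReal.ofReal l * volume A + ENNReal.ofReal (1 - l) * volume B ≤ volume S := by
  obtain ⟨a, ha⟩ := hAne
  obtain ⟨b, hb⟩ := hBne
  rw [hA.measure_eq_iSup_isCompact, hB.measure_eq_iSup_isCompact]
  simp only [ENNReal.mul_iSup, iSup_and']
  refine ENNReal.biSup_add_biSup_le' ⟨∅, empty_subset A, isCompact_empty⟩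
    ⟨∅, empty_subset B, isCompact_empty⟩ fun K hK L hL => ?_
  calc ENNReal.ofReal l * volume K + ENNReal.ofReal (1 - l) * volume L
      ≤ ENNReal.ofReal l * volume (insert a K)
        + ENNReal.ofReal (1 - l) * volume (insert b L) := by
        gcongr <;> exact subset_insert _ _
    _ ≤ volume S := volume_add_volume_le_of_isCompact hl0 hl1 (hK.2.insert a) (hL.2.insert b)
        (insert_nonempty _ _) (insert_nonempty _ _) fun x hx y hy =>
          hS x (insert_subset ha hK.1 hx) y (insert_subset hb hL.1 hy)

/-- The layer cake formula for a function with values in `[0, 1]`. -/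
theorem lintegral_eq_lintegral_meas_lt_of_le_one {α : Type*} [MeasurableSpace α] (μ : Measure α)
    {f : α → ENNReal} (hf : Measurable f) (hf1 : ∀ x, f x ≤ 1) :
    ∫⁻ x, f x ∂μ = ∫⁻ t in Ioi (0 : ℝ), μ {x | ENNReal.ofReal t < f x} := by
  have hne x : f x ≠ ⊤ := ne_top_of_le_ne_top ENNReal.one_ne_top (hf1 x)
  have := lintegral_eq_lintegral_meas_lt μ (f := fun x => (f x).toReal)
    (ae_of_all _ fun _ => ENNReal.toReal_nonneg) hf.ennreal_toReal.aemeasurable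
  simp only [ENNReal.ofReal_toReal (hne _)] at this
  rw [this]
  refine setLIntegral_congr_fun measurableSet_Ioi fun t ht => ?_
  simp only [ENNReal.ofReal_lt_iff_lt_toReal (le_of_lt ht) (hne _)]

/-- A linear form of the one-dimensional Prékopa–Leindler inequality, for functions of
supremum one. -/
theorem lintegral_add_lintegral_le_of_min_le {f g h : ℝ → ENNReal} {l : ℝ} (hl0 : 0 < l)
    (hl1 : l < 1) (hf : Measurable f) (hg : Measurable g) (hh : Measurable h)
    (hf1 : ⨆ x, f x = 1) (hg1 : ⨆ x, g x = 1)
    (H : ∀ x y, min (f x) (g y) ≤ h (l * x + (1 - l) * y)) :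
    ENNReal.ofReal l * (∫⁻ x, f x) + ENNReal.ofReal (1 - l) * ∫⁻ x, g x ≤ ∫⁻ x, h x := by
  have hf1' x : f x ≤ 1 := hf1 ▸ le_iSup f x
  have hg1' x : g x ≤ 1 := hg1 ▸ le_iSup g x
  have hlevel (k : ℝ → ENNReal) : Measurable fun t : ℝ => volume {x | ENNReal.ofReal t < k x} :=
    Antitone.measurable fun s t hst => measure_mono fun x hx =>
      (ENNReal.ofReal_le_ofReal hst).trans_lt hx
  calc ENNReal.ofReal l * (∫⁻ x, f x) + ENNReal.ofReal (1 - l) * ∫⁻ x, g x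
      = ∫⁻ t in Ioi (0 : ℝ), (ENNReal.ofReal l * volume {x | ENNReal.ofReal t < f x}
          + ENNReal.ofReal (1 - l) * volume {x | ENNReal.ofReal t < g x}) := by
        rw [lintegral_add_left ((hlevel f).const_mul _), lintegral_const_mul _ (hlevel f),
          lintegral_const_mul _ (hlevel g), lintegral_eq_lintegral_meas_lt_of_le_one _ hf hf1',
          lintegral_eq_lintegral_meas_lt_of_le_one _ hg hg1']
    _ ≤ ∫⁻ t in Ioi (0 : ℝ), volume {x | ENNReal.ofReal t < min (h x) 1} := by
        refine lintegral_mono fun t => ?_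
        rcases lt_or_ge (ENNReal.ofReal t) 1 with ht | ht
        · refine volume_add_volume_le hl0 hl1 (measurableSet_lt measurable_const hf)
            (measurableSet_lt measurable_const hg) (lt_iSup_iff.1 (ht.trans_eq hf1.symm))
            (lt_iSup_iff.1 (ht.trans_eq hg1.symm)) fun x hx y hy => ?_
          exact lt_min ((lt_min hx hy).trans_le (H x y)) ht
        · simp [((hf1' _).trans ht).not_gt, ((hg1' _).trans ht).not_gt]
    _ = ∫⁻ x, min (h x) 1 :=
        (lintegral_eq_lintegral_meas_lt_of_le_one _ (hh.min measurable_const)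
          fun x => min_le_right _ _).symm
    _ ≤ ∫⁻ x, h x := lintegral_mono fun x => min_le_left _ _

theorem ENNReal.min_le_rpow_mul_rpow {l : ℝ} (hl0 : 0 < l) (hl1 : l < 1) (a b : ENNReal) :
    min a b ≤ a ^ l * b ^ (1 - l) := by
  calc min a b = min a b ^ l * min a b ^ (1 - l) := by
        rw [← ENNReal.rpow_add_of_nonneg _ _ hl0.le (sub_pos.2 hl1).le]; simp
    _ ≤ a ^ l * b ^ (1 - l) :=
        mul_le_mul' (ENNReal.rpow_le_rpow (min_le_left _ _) hl0.le)
          (ENNReal.rpow_le_rpow (min_le_right _ _) (sub_pos.2 hl1).le)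

theorem ENNReal.rpow_mul_rpow_le_add {l : ℝ} (hl0 : 0 < l) (hl1 : l < 1) (a b : ENNReal) :
    a ^ l * b ^ (1 - l) ≤ ENNReal.ofReal l * a + ENNReal.ofReal (1 - l) * b := by
  have hl1' : 0 < 1 - l := sub_pos.2 hl1
  have := ENNReal.young_inequality (a ^ l) (b ^ (1 - l)) (p := l⁻¹) (q := (1 - l)⁻¹)
    (Real.holderConjugate_iff.2 ⟨(one_lt_inv₀ hl0).2 hl1, by simp⟩)
  rwa [← ENNReal.rpow_mul, ← ENNReal.rpow_mul, mul_inv_cancel₀ hl0.ne', mul_inv_cancel₀ hl1'.ne',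
    ENNReal.rpow_one, ENNReal.rpow_one, ENNReal.ofReal_inv_of_pos hl0,
    ENNReal.ofReal_inv_of_pos hl1', ENNReal.div_eq_inv_mul, ENNReal.div_eq_inv_mul, inv_inv,
    inv_inv] at this

/-- The one-dimensional Prékopa–Leindler inequality for bounded functions. -/
theorem prekopa_leindler {f g h : ℝ → ENNReal} {l : ℝ} (hl0 : 0 < l)
    (hl1 : l < 1) (hf : Measurable f) (hg : Measurable g) (hh : Measurable h)
    (hfb : ⨆ x, f x ≠ ⊤) (hgb : ⨆ x, g x ≠ ⊤)
    (H : ∀ x y, f x ^ l * g y ^ (1 - l) ≤ h (l * x + (1 - l) * y)) :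
    (∫⁻ x, f x) ^ l * (∫⁻ x, g x) ^ (1 - l) ≤ ∫⁻ x, h x := by
  have hl1' : 0 < 1 - l := sub_pos.2 hl1
  set F := ⨆ x, f x with hF
  set G := ⨆ x, g x with hG
  rcases eq_or_ne F 0 with hF0 | hF0
  · have : f = 0 := funext fun x => le_antisymm ((le_iSup f x).trans_eq hF0) bot_le
    simp [this, hl0]
  rcases eq_or_ne G 0 with hG0 | hG0
  · have : g = 0 := funext fun x => le_antisymm ((le_iSup g x).trans_eq hG0) bot_le
    simp [this, hl1']
  have hmul (a b c d : ENNReal) :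
      (a * b) ^ l * (c * d) ^ (1 - l) = (a ^ l * c ^ (1 - l)) * (b ^ l * d ^ (1 - l)) := by
    rw [ENNReal.mul_rpow_of_nonneg _ _ hl0.le, ENNReal.mul_rpow_of_nonneg _ _ hl1'.le]; ring
  set K := F⁻¹ ^ l * G⁻¹ ^ (1 - l) with hK
  have hK0 : K ≠ 0 := by simp [hK, hfb, hgb, ENNReal.rpow_eq_zero_iff, hl0.not_gt, hl1'.not_gt]
  have hKtop : K ≠ ⊤ := ENNReal.mul_ne_top
    (ENNReal.rpow_ne_top_of_nonneg hl0.le (ENNReal.inv_ne_top.2 hF0))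
    (ENNReal.rpow_ne_top_of_nonneg hl1'.le (ENNReal.inv_ne_top.2 hG0))
  have key := lintegral_add_lintegral_le_of_min_le (f := fun x => F⁻¹ * f x)
    (g := fun x => G⁻¹ * g x) (h := fun x => K * h x) hl0 hl1 (hf.const_mul _) (hg.const_mul _)
    (hh.const_mul _) (by rw [← ENNReal.mul_iSup, ENNReal.inv_mul_cancel hF0 hfb])
    (by rw [← ENNReal.mul_iSup, ENNReal.inv_mul_cancel hG0 hgb]) fun x y =>
      (ENNReal.min_le_rpow_mul_rpow hl0 hl1 _ _).trans
        ((hmul _ _ _ _).trans_le (mul_le_mul_right (H x y) K))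
  have := (ENNReal.rpow_mul_rpow_le_add hl0 hl1 _ _).trans key
  rw [lintegral_const_mul _ hf, lintegral_const_mul _ hg, lintegral_const_mul _ hh, hmul] at this
  exact (ENNReal.mul_le_mul_iff_right hK0 hKtop).1 this

/-- The Prékopa–Leindler inequality for the standard Gaussian measure on the line. -/
theorem prekopa_leindler_gaussianReal {f g h : ℝ → ENNReal} {l : ℝ} (hl0 : 0 < l) (hl1 : l < 1)
    (hf : Measurable f) (hg : Measurable g) (hh : Measurable h)
    (hf1 : ∀ x, f x ≤ 1) (hg1 : ∀ x, g x ≤ 1)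
    (H : ∀ x y, f x ^ l * g y ^ (1 - l) ≤
      ENNReal.ofReal (exp (l * (1 - l) / 2 * (x - y) ^ 2)) * h (l * x + (1 - l) * y)) :
    (∫⁻ x, f x ∂gaussianReal 0 1) ^ l * (∫⁻ x, g x ∂gaussianReal 0 1) ^ (1 - l) ≤
      ∫⁻ x, h x ∂gaussianReal 0 1 := by
  have hl1' : 0 < 1 - l := sub_pos.2 hl1
  set c : ℝ := (√(2 * π))⁻¹ with hc
  have hc0 : 0 < c := by positivity
  have hφ x : gaussianPDF 0 1 x = ENNReal.ofReal (c * exp (-x ^ 2 / 2)) := by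
    simp [gaussianPDF, gaussianPDFReal, hc]
  have hφm : Measurable (gaussianPDF 0 1) := measurable_gaussianPDF 0 1
  have hφc x : gaussianPDF 0 1 x ≤ ENNReal.ofReal c := by
    rw [hφ]
    refine ENNReal.ofReal_le_ofReal (mul_le_of_le_one_right hc0.le (exp_le_one_iff.2 ?_))
    nlinarith [sq_nonneg x]
  have hbdd {k : ℝ → ENNReal} (hk : ∀ x, k x ≤ 1) : ⨆ x, gaussianPDF 0 1 x * k x ≠ ⊤ :=
    ne_top_of_le_ne_top ENNReal.ofReal_ne_top
      (iSup_le fun x => (mul_le_mul' (hφc x) (hk x)).trans_eq (mul_one _))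
  have hdens x y : gaussianPDF 0 1 x ^ l * gaussianPDF 0 1 y ^ (1 - l) *
      ENNReal.ofReal (exp (l * (1 - l) / 2 * (x - y) ^ 2))
        = gaussianPDF 0 1 (l * x + (1 - l) * y) := by
    rw [hφ, hφ, hφ, ENNReal.ofReal_rpow_of_nonneg (by positivity) hl0.le,
      ENNReal.ofReal_rpow_of_nonneg (by positivity) hl1'.le, ← ENNReal.ofReal_mul (by positivity),
      ← ENNReal.ofReal_mul (by positivity)]
    congr 1
    rw [Real.mul_rpow hc0.le (exp_pos _).le, Real.mul_rpow hc0.le (exp_pos _).le,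
      ← Real.exp_mul, ← Real.exp_mul]
    have hcc : c ^ l * c ^ (1 - l) = c := by rw [← Real.rpow_add hc0]; simp
    calc c ^ l * exp (-x ^ 2 / 2 * l) * (c ^ (1 - l) * exp (-y ^ 2 / 2 * (1 - l))) *
          exp (l * (1 - l) / 2 * (x - y) ^ 2)
        = (c ^ l * c ^ (1 - l)) * (exp (-x ^ 2 / 2 * l) * exp (-y ^ 2 / 2 * (1 - l)) *
          exp (l * (1 - l) / 2 * (x - y) ^ 2)) := by ring
      _ = c * exp (-(l * x + (1 - l) * y) ^ 2 / 2) := by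
        rw [hcc, ← exp_add, ← exp_add]; congr 2; ring
  rw [gaussianReal_of_var_ne_zero _ one_ne_zero, lintegral_withDensity_eq_lintegral_mul _ hφm hf,
    lintegral_withDensity_eq_lintegral_mul _ hφm hg,
    lintegral_withDensity_eq_lintegral_mul _ hφm hh]
  refine prekopa_leindler hl0 hl1 (hφm.mul hf) (hφm.mul hg) (hφm.mul hh) (hbdd hf1) (hbdd hg1)
    fun x y => ?_
  simp only [Pi.mul_apply]
  rw [ENNReal.mul_rpow_of_nonneg _ _ hl0.le, ENNReal.mul_rpow_of_nonneg _ _ hl1'.le,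
    mul_mul_mul_comm, ← hdens, mul_assoc (_ * _) (ENNReal.ofReal _)]
  exact mul_le_mul_right (H x y) _

/-- The Prékopa–Leindler inequality for the standard Gaussian measure on `Fin n → ℝ`. -/
theorem prekopa_leindler_pi_gaussianReal {l : ℝ} (hl0 : 0 < l) (hl1 : l < 1) (n : ℕ)
    {f g h : (Fin n → ℝ) → ENNReal} (hf : Measurable f) (hg : Measurable g) (hh : Measurable h)
    (hf1 : ∀ x, f x ≤ 1) (hg1 : ∀ x, g x ≤ 1)
    (H : ∀ x y, f x ^ l * g y ^ (1 - l) ≤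
      ENNReal.ofReal (exp (l * (1 - l) / 2 * ∑ i, (x i - y i) ^ 2)) * h (l • x + (1 - l) • y)) :
    (∫⁻ x, f x ∂Measure.pi fun _ => gaussianReal 0 1) ^ l *
      (∫⁻ x, g x ∂Measure.pi fun _ => gaussianReal 0 1) ^ (1 - l) ≤
      ∫⁻ x, h x ∂Measure.pi fun _ => gaussianReal 0 1 := by
  induction n with
  | zero =>
    have hconst (k : (Fin 0 → ℝ) → ENNReal) :
        ∫⁻ x, k x ∂Measure.pi (fun _ => gaussianReal 0 1) = k default := by
      rw [lintegral_unique, measure_univ, mul_one]; exact congrArg k (Subsingleton.elim _ _)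
    rw [hconst, hconst, hconst]
    refine (H default default).trans_eq ?_
    rw [Subsingleton.elim (l • default + (1 - l) • default : Fin 0 → ℝ) default]
    simp
  | succ n ih =>
    have hcons_eq (p : ℝ × (Fin n → ℝ)) :
        (MeasurableEquiv.piFinSuccAbove (fun _ : Fin (n + 1) => ℝ) 0).symm p =
          Fin.cons p.1 p.2 := by
      simp [MeasurableEquiv.piFinSuccAbove_symm_apply, Fin.insertNthEquiv]
    have hcons : Measurable fun p : ℝ × (Fin n → ℝ) => (Fin.cons p.1 p.2 : Fin (n + 1) → ℝ) := by
      simp only [← hcons_eq]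
      exact MeasurableEquiv.measurable _
    have hsplit {k : (Fin (n + 1) → ℝ) → ENNReal} (hk : Measurable k) :
        ∫⁻ x, k x ∂Measure.pi (fun _ => gaussianReal 0 1) =
          ∫⁻ s, ∫⁻ x, k (Fin.cons s x) ∂Measure.pi (fun _ => gaussianReal 0 1)
            ∂gaussianReal 0 1 := by
      rw [← ((measurePreserving_piFinSuccAbove
        (fun _ : Fin (n + 1) => gaussianReal 0 1) 0).symm).lintegral_comp hk]
      simp only [hcons_eq]
      exact lintegral_prod _ (hk.comp hcons).aemeasurable
    have hle {k : (Fin (n + 1) → ℝ) → ENNReal} (hk1 : ∀ x, k x ≤ 1) (s : ℝ) :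
        ∫⁻ x, k (Fin.cons s x) ∂Measure.pi (fun _ => gaussianReal 0 1) ≤ 1 :=
      (lintegral_mono fun x => hk1 _).trans_eq (by simp)
    rw [hsplit hf, hsplit hg, hsplit hh]
    refine prekopa_leindler_gaussianReal hl0 hl1 (hf.comp hcons).lintegral_prod_right'
      (hg.comp hcons).lintegral_prod_right' (hh.comp hcons).lintegral_prod_right'
      (hle hf1) (hle hg1) fun s t => ?_
    have hcs (s : ℝ) : Measurable fun x : Fin n → ℝ => (Fin.cons s x : Fin (n + 1) → ℝ) :=
      hcons.comp measurable_prodMk_left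
    rw [← lintegral_const_mul (f := fun x => h (Fin.cons _ x)) _ (hh.comp (hcs _))]
    refine ih (hf.comp (hcs s)) (hg.comp (hcs t)) ((hh.comp (hcs _)).const_mul _)
      (fun _ => hf1 _) (fun _ => hg1 _) fun x y => ?_
    refine (H _ _).trans_eq ?_
    rw [← mul_assoc, ← ENNReal.ofReal_mul (by positivity), ← exp_add, Fin.sum_univ_succ]
    congr 2
    · simp; ring
    · refine funext fun i => ?_
      refine Fin.cases ?_ (fun i => ?_) i <;> simp

/-- Concentration for two separated sets under the standard Gaussian measure. -/
theorem stdGaussian_rpow_mul_rpow_le {l t : ℝ} (hl0 : 0 < l) (hl1 : l < 1) (ht : 0 ≤ t) {n : ℕ}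
    {A B : Set (EuclideanSpace ℝ (Fin n))} (hA : MeasurableSet A) (hB : MeasurableSet B)
    (hAB : ∀ x ∈ A, ∀ y ∈ B, t ≤ ‖x - y‖) :
    stdGaussian (EuclideanSpace ℝ (Fin n)) A ^ l *
      stdGaussian (EuclideanSpace ℝ (Fin n)) B ^ (1 - l) ≤
        ENNReal.ofReal (exp (-(l * (1 - l) / 2 * t ^ 2))) := by
  have hl1' : 0 < 1 - l := sub_pos.2 hl1
  have hm : Measurable (WithLp.toLp 2 : (Fin n → ℝ) → EuclideanSpace ℝ (Fin n)) := by fun_prop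
  rw [← map_pi_eq_stdGaussian, Measure.map_apply hm hA, Measure.map_apply hm hB,
    ← lintegral_indicator_one (hm hA), ← lintegral_indicator_one (hm hB)]
  refine (prekopa_leindler_pi_gaussianReal (h := fun _ => ENNReal.ofReal
    (exp (-(l * (1 - l) / 2 * t ^ 2)))) hl0 hl1 n (measurable_const.indicator (hm hA))
    (measurable_const.indicator (hm hB)) measurable_const
    (fun x => indicator_le_self' (fun _ _ => zero_le_one) x)
    (fun x => indicator_le_self' (fun _ _ => zero_le_one) x) fun x y => ?_).trans_eq (by simp)
  by_cases hx : x ∈ WithLp.toLp 2 ⁻¹' A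
  swap
  · simp [indicator_of_notMem hx, hl0]
  by_cases hy : y ∈ WithLp.toLp 2 ⁻¹' B
  swap
  · simp [indicator_of_notMem hy, hl1']
  rw [indicator_of_mem hx, indicator_of_mem hy, ENNReal.one_rpow, ENNReal.one_rpow,
    mul_one, ← ENNReal.ofReal_mul (exp_pos _).le, ← exp_add, ENNReal.one_le_ofReal, one_le_exp_iff]
  have h1 : t ^ 2 ≤ ∑ i, (x i - y i) ^ 2 := by
    have := pow_le_pow_left₀ ht (hAB _ hx _ hy) 2
    simpa [EuclideanSpace.norm_sq_eq] using this
  have h2 : l * (1 - l) / 2 * t ^ 2 ≤ l * (1 - l) / 2 * ∑ i, (x i - y i) ^ 2 := by gcongr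
  linarith

open Matrix in
/-- A centered Gaussian measure on a Euclidean space is a linear image of the standard one. -/
theorem exists_stdGaussian_map_eq {n : ℕ} (μ : Measure (EuclideanSpace ℝ (Fin n))) [IsGaussian μ]
    (hμ : μ[id] = 0) :
    ∃ T : EuclideanSpace ℝ (Fin n) →L[ℝ] EuclideanSpace ℝ (Fin n),
      (stdGaussian (EuclideanSpace ℝ (Fin n))).map T = μ := by
  set b := (EuclideanSpace.basisFun (Fin n) ℝ).toBasis
  set S := LinearMap.toMatrix₂ b b (covarianceBilin μ).toBilinForm
  have hbilin (x y : EuclideanSpace ℝ (Fin n)) : covarianceBilin μ x y = x ⬝ᵥ S *ᵥ y :=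
    apply_eq_dotProduct_toMatrix₂_mulVec b b (covarianceBilin μ).toBilinForm x y
  have hS : S.PosSemidef := by
    refine Matrix.PosSemidef.of_dotProduct_mulVec_nonneg (Matrix.IsHermitian.ext fun i j => ?_)
      fun x => ?_
    · simp only [S, LinearMap.toMatrix₂_apply, star_trivial]
      exact covarianceBilin_comm _ _
    · exact (covarianceBilin_self_nonneg (WithLp.toLp 2 x)).trans_eq (hbilin _ _)
  have heq : μ = multivariateGaussian 0 S := by
    refine IsGaussian.ext (by rw [hμ, integral_id_multivariateGaussian']) ?_
    ext x y
    rw [covarianceBilin_multivariateGaussian hS, hbilin]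
  rw [heq, multivariateGaussian]
  simp only [zero_add]
  exact ⟨_, rfl⟩

/-- The Borell–TIS inequality for a centered Gaussian measure on a Euclidean space, in a
two-level form. -/
theorem IsGaussian.rpow_mul_rpow_le {l m u σ : ℝ} (hl0 : 0 < l) (hl1 : l < 1) (hmu : m ≤ u)
    (hσ : 0 < σ) {n : ℕ} (μ : Measure (EuclideanSpace ℝ (Fin n))) [IsGaussian μ]
    (hμ : μ[id] = 0) (hvar : ∀ i, Var[fun x => x i; μ] ≤ σ ^ 2) :
    μ {x | ∀ i, x i ≤ m} ^ l * μ {x | ∃ i, u < x i} ^ (1 - l) ≤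
      ENNReal.ofReal (exp (-(l * (1 - l) / 2 * ((u - m) / σ) ^ 2))) := by
  obtain ⟨T, hT⟩ := exists_stdGaussian_map_eq μ hμ
  have hTm : Measurable T := T.continuous.measurable
  have hA : MeasurableSet {x : EuclideanSpace ℝ (Fin n) | ∀ i, x i ≤ m} := by
    simp only [ofPred_forall]
    exact MeasurableSet.iInter fun i => measurableSet_le (by fun_prop) measurable_const
  have hB : MeasurableSet {x : EuclideanSpace ℝ (Fin n) | ∃ i, u < x i} := by
    simp only [ofPred_exists]
    exact MeasurableSet.iUnion fun i => measurableSet_lt measurable_const (by fun_prop)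
  have hnorm i : ‖(EuclideanSpace.proj i : EuclideanSpace ℝ (Fin n) →L[ℝ] ℝ).comp T‖ ≤ σ := by
    refine le_of_sq_le_sq ?_ hσ.le
    rw [← variance_dual_stdGaussian]
    refine le_trans (le_of_eq ?_) (hvar i)
    rw [← hT, variance_map (Measurable.aemeasurable (by fun_prop)) hTm.aemeasurable]
    rfl
  rw [← hT, Measure.map_apply hTm hA, Measure.map_apply hTm hB]
  refine stdGaussian_rpow_mul_rpow_le hl0 hl1 (div_nonneg (sub_nonneg.2 hmu) hσ.le) (hTm hA)
    (hTm hB) fun x hx y ⟨i, hy⟩ => ?_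
  rw [div_le_iff₀ hσ, norm_sub_rev]
  have h1 := ((EuclideanSpace.proj i : EuclideanSpace ℝ (Fin n) →L[ℝ] ℝ).comp T).le_of_opNorm_le
    (hnorm i) (y - x)
  have h2 : u - m ≤ (T y) i - (T x) i := sub_le_sub hy.le (hx i)
  have h3 : ((EuclideanSpace.proj i : EuclideanSpace ℝ (Fin n) →L[ℝ] ℝ).comp T) (y - x)
      = (T y) i - (T x) i := by simp
  rw [h3] at h1
  linarith [le_abs_self ((T y) i - (T x) i), Real.norm_eq_abs ((T y) i - (T x) i)]

/-- The tail of the maximum of a centered Gaussian vector, in terms of a median-type level `m`. -/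
theorem measure_exists_lt_le {Ω : Type*} [MeasurableSpace Ω] (P : Measure Ω)
    [IsProbabilityMeasure P] {k : ℕ} {X : Fin k → Ω → ℝ} (hX : ∀ i, Measurable (X i))
    (hlin : ∀ c : Fin k → ℝ, IsCenteredGaussianRV P (fun ω => ∑ i, c i * X i ω))
    {m u σ : ℝ} (hσ : 0 < σ) (hvar : ∀ i, ∫ ω, X i ω ^ 2 ∂P ≤ σ ^ 2)
    (hm : 1 / 2 ≤ P {ω | ∀ i, X i ω ≤ m}) (hu : m + σ < u) :
    P {ω | ∃ i, u < X i ω} ≤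
      ENNReal.ofReal (exp ((1 / 2 + log 2) * ((u - m) / σ) - ((u - m) / σ) ^ 2 / 2)) := by
  set V : Ω → EuclideanSpace ℝ (Fin k) := fun ω => WithLp.toLp 2 fun i => X i ω
  have hV : Measurable V := by fun_prop
  set μ := P.map V with hμdef
  have : IsProbabilityMeasure μ := Measure.isProbabilityMeasure_map hV.aemeasurable
  have hdual (L : EuclideanSpace ℝ (Fin k) →L[ℝ] ℝ) : ∃ v : NNReal, μ.map L = gaussianReal 0 v := by
    obtain ⟨v, hv⟩ := hlin fun i => L (EuclideanSpace.basisFun (Fin k) ℝ i)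
    refine ⟨v, ?_⟩
    rw [← hv, hμdef, Measure.map_map L.continuous.measurable hV]
    congr 1
    ext ω
    rw [Function.comp_apply, ← (EuclideanSpace.basisFun (Fin k) ℝ).sum_repr (V ω), map_sum]
    simp [V, mul_comm]
  have hgauss : IsGaussian μ := isGaussian_of_map_eq_gaussianReal fun L => ⟨0, hdual L⟩
  have hmean : μ[id] = 0 := by
    ext i
    obtain ⟨v, hv⟩ := hdual (EuclideanSpace.proj i)
    have h1 := (EuclideanSpace.proj i : EuclideanSpace ℝ (Fin k) →L[ℝ] ℝ).integral_comp_id_comm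
      (μ := μ) IsGaussian.integrable_id
    have h2 := integral_map (μ := μ) (f := fun x : ℝ => x)
      (EuclideanSpace.proj i : EuclideanSpace ℝ (Fin k) →L[ℝ] ℝ).continuous.measurable.aemeasurable
      (by fun_prop)
    rw [hv, integral_id_gaussianReal] at h2
    exact h1.symm.trans h2.symm
  have hvar' i : Var[fun x => x i; μ] ≤ σ ^ 2 := by
    rw [hμdef, variance_map (Measurable.aemeasurable (by fun_prop)) hV.aemeasurable]
    exact (variance_le_expectation_sq (hX i).aestronglyMeasurable).trans (hvar i)
  set t := (u - m) / σ
  have ht : 1 < t := by rw [lt_div_iff₀ hσ]; linarith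
  have ht0 : 0 < t := one_pos.trans ht
  have hl0 : 0 < 1 - 1 / t := by rw [sub_pos, div_lt_one ht0]; exact ht
  have hl1 : 1 - 1 / t < 1 := by linarith [one_div_pos.2 ht0]
  have key := IsGaussian.rpow_mul_rpow_le hl0 hl1 (by linarith) hσ μ hmean hvar' (m := m) (u := u)
  have hA : MeasurableSet {x : EuclideanSpace ℝ (Fin k) | ∀ i, x i ≤ m} := by
    simp only [ofPred_forall]
    exact MeasurableSet.iInter fun i => measurableSet_le (by fun_prop) measurable_const
  have hB : MeasurableSet {x : EuclideanSpace ℝ (Fin k) | ∃ i, u < x i} := by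
    simp only [ofPred_exists]
    exact MeasurableSet.iUnion fun i => measurableSet_lt measurable_const (by fun_prop)
  rw [Measure.map_apply hV hA, Measure.map_apply hV hB] at key
  change P {ω | ∀ i, X i ω ≤ m} ^ _ * P {ω | ∃ i, u < X i ω} ^ _ ≤ _ at key
  replace key : _ ≤ ENNReal.ofReal (exp (-((1 - 1 / t) * (1 - (1 - 1 / t)) / 2 * t ^ 2))) :=
    (mul_le_mul_left (ENNReal.rpow_le_rpow hm hl0.le) _).trans key
  set q := P {ω | ∃ i, u < X i ω}
  have hqtop : q ≠ ⊤ := measure_ne_top P _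
  rw [← ENNReal.ofReal_toReal hqtop]
  apply ENNReal.ofReal_le_ofReal
  have hq0 : 0 ≤ q.toReal := ENNReal.toReal_nonneg
  rcases hq0.eq_or_lt with hq | hq
  · rw [← hq]; exact (exp_pos _).le
  have key2 := ENNReal.toReal_mono ENNReal.ofReal_ne_top key
  rw [ENNReal.toReal_mul, ← ENNReal.toReal_rpow, ← ENNReal.toReal_rpow,
    ENNReal.toReal_ofReal (exp_pos _).le] at key2
  have hhalf : ((1 / 2 : ENNReal)).toReal = 1 / 2 := by simp
  rw [hhalf] at key2
  have key4 := Real.log_le_log (by positivity) key2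
  rw [Real.log_exp, Real.log_mul (by positivity) (by positivity), Real.log_rpow (by norm_num),
    Real.log_rpow hq, one_div (2 : ℝ), Real.log_inv] at key4
  rw [← Real.log_le_iff_le_exp hq]
  have key5 := mul_le_mul_of_nonneg_left key4 ht0.le
  have h1 : t * ((1 - 1 / t) * -log 2 + (1 - (1 - 1 / t)) * log q.toReal)
      = -(t - 1) * log 2 + log q.toReal := by field_simp; ring
  have h2 : t * -((1 - 1 / t) * (1 - (1 - 1 / t)) / 2 * t ^ 2) = -(t ^ 2 / 2) + t / 2 := by
    field_simp; ring
  rw [h1, h2] at key5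
  linarith [Real.log_pos one_lt_two]

/-- The Borell–TIS inequality, up to a factor exponential in the level, for a centered Gaussian
process with continuous paths on a compact space. -/
theorem IsCenteredGaussianProcess.exists_measure_exists_lt_le {Ω M : Type*} [MeasurableSpace Ω]
    [MetricSpace M] [CompactSpace M] [Nonempty M] [MeasurableSpace M] (P : Measure Ω)
    [IsProbabilityMeasure P] {f : Ω × M → ℝ} (hf : IsCenteredGaussianProcess P f)
    (hcont : ∀ᵐ ω ∂P, Continuous fun x => f (ω, x)) {σ : ℝ} (hσ : 0 < σ)
    (hvar : ∀ x, ∫ ω, f (ω, x) ^ 2 ∂P ≤ σ ^ 2) :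
    ∃ m : ℝ, 0 ≤ m ∧ ∀ u, m + σ < u → P {ω | ∃ x, u < f (ω, x)} ≤
      ENNReal.ofReal (exp ((1 / 2 + log 2) * ((u - m) / σ) - ((u - m) / σ) ^ 2 / 2)) := by
  set d := TopologicalSpace.denseSeq M
  have hmeas j : Measurable fun ω => f (ω, d j) := hf.1.comp measurable_prodMk_right
  obtain ⟨N, hN⟩ : ∃ N : ℕ, 1 / 2 < P {ω | ∀ j, f (ω, d j) ≤ N} := by
    have hmono : Monotone fun N : ℕ => {ω | ∀ j, f (ω, d j) ≤ N} := fun N N' hNN' ω hω j =>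
      (hω j).trans (Nat.cast_le.2 hNN')
    have hunion : P (⋃ N : ℕ, {ω | ∀ j, f (ω, d j) ≤ N}) = 1 := by
      rw [← measure_univ (μ := P)]
      refine measure_congr (eventuallyEq_univ.2 ?_)
      filter_upwards [hcont] with ω hω
      obtain ⟨C, hC⟩ := (isCompact_range hω).bddAbove
      obtain ⟨N, hN⟩ := exists_nat_ge C
      exact mem_iUnion.2 ⟨N, fun j => (hC (mem_range_self _)).trans hN⟩
    have htend := tendsto_measure_iUnion_atTop (μ := P) hmono
    rw [hunion] at htend
    exact (htend.eventually (lt_mem_nhds (by simp))).exists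
  refine ⟨N, N.cast_nonneg, fun u hu => ?_⟩
  have hfin (k : ℕ) := measure_exists_lt_le P (X := fun (i : Fin k) ω => f (ω, d i))
    (fun i => hmeas i) (fun c => hf.2 k c fun i => d i) hσ (fun i => hvar _)
    (hN.le.trans (measure_mono fun ω hω i => hω i)) hu
  have hmono : Monotone fun k : ℕ => {ω | ∃ i : Fin k, u < f (ω, d i)} :=
    fun k k' hkk' ω hω => hω.elim fun i hi => ⟨Fin.castLE hkk' i, hi⟩
  refine le_trans (measure_mono_ae ?_)
    ((hmono.measure_iUnion (μ := P)).trans_le (iSup_le hfin))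
  filter_upwards [hcont] with ω hω hmem
  obtain ⟨x, hx⟩ : ∃ x, u < f (ω, x) := hmem
  obtain ⟨j, hy⟩ := (TopologicalSpace.denseRange_denseSeq M).exists_mem_open
    (isOpen_lt continuous_const hω) ⟨x, hx⟩
  exact mem_iUnion.2 ⟨j + 1, Fin.last j, by simpa using hy⟩
/-- Paper: Proposition 6.1 (negative `R₀`, dimension `n > 2`): the probability that
`R₀ − a(n−1)h − a²(n−1)(n−2)B/4 > 0` somewhere is `O(exp(α/(a(n−1)) − 1/(2a²(n−1)²σ_v²)))`. -/
theorem stmt_15 {Ω M : Type*} [MeasurableSpace Ω] [MetricSpace M] [CompactSpace M] [Nonempty M]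
    [MeasurableSpace M] [BorelSpace M]
    (P : Measure Ω) [IsProbabilityMeasure P]
    (n : ℕ) (hn : 2 < n)
    (R₀ : M → ℝ) (hR₀cont : Continuous R₀) (hR₀neg : ∀ x, R₀ x < 0)
    (h : Ω × M → ℝ)
    (hgauss : IsCenteredGaussianProcess P h)
    (hcont : ∀ᵐ ω ∂P, Continuous fun x => h (ω, x))
    (B : Ω × M → ℝ) (hBmeas : Measurable B) (hBnonneg : ∀ ω x, 0 ≤ B (ω, x))
    (σvsq : ℝ)
    (hσ : IsLUB (Set.range fun x : M => (∫ ω, h (ω, x) ^ 2 ∂P) / R₀ x ^ 2) σvsq)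
    (hσpos : 0 < σvsq) :
    ∃ α C a₀ : ℝ, 0 < α ∧ 0 < a₀ ∧ ∀ a : ℝ, 0 < a → a < a₀ →
      P {ω | ∃ x : M, 0 < R₀ x - a * ((n : ℝ) - 1) * h (ω, x)
            - a ^ 2 * ((n : ℝ) - 1) * ((n : ℝ) - 2) / 4 * B (ω, x)}
        ≤ ENNReal.ofReal
            (C * Real.exp (α / (a * ((n : ℝ) - 1))
              - 1 / (2 * a ^ 2 * ((n : ℝ) - 1) ^ 2 * σvsq))) := by
  have hv : IsCenteredGaussianProcess P fun p => h p / R₀ p.2 := by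
    refine ⟨hgauss.1.div (hR₀cont.measurable.comp measurable_snd), fun k c x => ?_⟩
    obtain ⟨v, hv⟩ := hgauss.2 k (fun i => c i / R₀ (x i)) x
    refine ⟨v, ?_⟩
    rw [← hv]
    congr 1
    ext ω
    exact Finset.sum_congr rfl fun i _ => by ring
  set σ := √σvsq with hσdef
  have hσ0 : 0 < σ := Real.sqrt_pos.2 hσpos
  have hσsq : σ ^ 2 = σvsq := Real.sq_sqrt hσpos.le
  obtain ⟨m, hm0, hm⟩ := hv.exists_measure_exists_lt_le P
    (hcont.mono fun ω hω => hω.div hR₀cont fun x => (hR₀neg x).ne) hσ0 fun x => by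
      rw [hσsq]
      refine le_trans (le_of_eq ?_) (hσ.1 (mem_range_self x))
      simp only [div_pow, integral_div]
  have hn1 : (0 : ℝ) < n - 1 := by
    have : (2 : ℝ) < n := by exact_mod_cast hn
    linarith
  have hn2 : (0 : ℝ) < n - 2 := by
    have : (2 : ℝ) < n := by exact_mod_cast hn
    linarith
  have hlog : 0 < log 2 := Real.log_pos one_lt_two
  refine ⟨(1 / 2 + log 2) / σ + m / σ ^ 2, 1, 1 / ((n - 1) * (m + σ)), by positivity,
    by positivity, fun a ha0 ha => ?_⟩
  have hs : 0 < a * ((n : ℝ) - 1) := by positivity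
  set u := 1 / (a * ((n : ℝ) - 1)) with hu
  have hmu : m + σ < u := by
    rw [lt_div_iff₀ (by positivity)] at ha
    rw [hu, lt_div_iff₀ hs]
    linarith
  refine (measure_mono ?_).trans ((hm u hmu).trans (ENNReal.ofReal_le_ofReal ?_))
  · rintro ω ⟨x, hx⟩
    refine ⟨x, ?_⟩
    have hB : 0 ≤ a ^ 2 * ((n : ℝ) - 1) * ((n : ℝ) - 2) / 4 * B (ω, x) :=
      mul_nonneg (by positivity) (hBnonneg ω x)
    rw [hu, lt_div_iff_of_neg (hR₀neg x), one_div_mul_eq_div, lt_div_iff₀ hs]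
    linarith
  · rw [one_mul, exp_le_exp, ← hσsq]
    have h1 : ((1 / 2 + log 2) / σ + m / σ ^ 2) / (a * ((n : ℝ) - 1)) -
        1 / (2 * a ^ 2 * ((n : ℝ) - 1) ^ 2 * σ ^ 2) -
        ((1 / 2 + log 2) * ((u - m) / σ) - ((u - m) / σ) ^ 2 / 2) =
        (1 / 2 + log 2) * m / σ + m ^ 2 / (2 * σ ^ 2) := by
      rw [hu]; field_simp; ring
    have h2 : 0 ≤ (1 / 2 + log 2) * m / σ + m ^ 2 / (2 * σ ^ 2) := by positivity
    linarith
end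

section
/- Let M be a compact metric space, n an even positive integer, and Q₀ : M → ℝ continuous. Let f, h : Ω × M → ℝ be jointly centered Gaussian processes (every finite real linear combination of values of f and of h is a centered real Gaussian random variable), each with almost surely continuous sample paths, with sup_x E[f(x)²] and sup_x E[h(x)²] finite. Set w := h − n·Q₀·f and σ_w² := sup_{x∈M} E[w(x)²]; assume 0 < σ_w² < ∞ and that this supremum is attained. For a, u > 0 define D(a)(ω,x) := Q₀(x)·(e^{−n a f(ω,x)} − 1) + a·e^{−n a f(ω,x)}·h(ω,x). Then as a → 0 and u → 0 with u/a → ∞, log Prob{ sup_{x∈M} |D(a)(ω,x)| > u } ~ −u²/(2a²σ_w²); precisely, for every ε > 0 there is δ > 0 such that whenever 0 < u < δ and u/a > 1/δ, the ratio of log Prob{ sup_{x∈M} |D(a)| > u } to −u²/(2a²σ_w²) lies in (1−ε, 1+ε). -/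
open MeasureTheory ProbabilityTheory Real Filter Set

/-- Two random fields are jointly centered Gaussian: both jointly measurable, and every
finite real linear combination of values of `f` and of `h` is a centered Gaussian. -/
def IsJointlyCenteredGaussianPair {Ω T : Type*} [MeasurableSpace Ω] [MeasurableSpace T]
    (P : Measure Ω) (f h : Ω × T → ℝ) : Prop :=
  Measurable f ∧ Measurable h ∧
    ∀ (k : ℕ) (cf ch : Fin k → ℝ) (x y : Fin k → T),
      IsCenteredGaussianRV P (fun ω => ∑ i, (cf i * f (ω, x i) + ch i * h (ω, y i)))

/-- A real-valued random field is centered Gaussian if its values are measurable and all their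
finite linear combinations are centered Gaussian. -/
def IsCenteredGaussianField {Ω T : Type*} [MeasurableSpace Ω] (P : Measure Ω)
    (X : T → Ω → ℝ) : Prop :=
  (∀ t, Measurable (X t)) ∧ ∀ (k : ℕ) (c : Fin k → ℝ) (t : Fin k → T),
    IsCenteredGaussianRV P (fun ω => ∑ i, c i * X (t i) ω)

/-- The constant in front of the exponential in the tail bound for Gaussian suprema. -/
noncomputable def ferniqueConst : ENNReal :=
  .ofReal (rexp (Fernique.logRatio (3 / 4)))
    + ∑' n : ℕ, .ofReal (rexp (-2⁻¹ * Real.log ((3 / 4 : ENNReal) / (1 - 3 / 4)).toReal * 2 ^ n))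

lemma one_sub_three_quarters : (1 : ENNReal) - 3 / 4 = 1 / 4 := by
  refine ENNReal.sub_eq_of_eq_add (by finiteness) ?_
  rw [← ENNReal.add_div]
  norm_num
  exact (ENNReal.div_self (by norm_num) (by norm_num)).symm

lemma ferniqueConst_ne_top : ferniqueConst ≠ ⊤ := by
  refine (ENNReal.add_lt_top.mpr ⟨ENNReal.ofReal_lt_top, ?_⟩).ne
  refine Summable.tsum_ofReal_lt_top <|
    Real.summable_exp_nat_mul_of_ge ?_ (fun i ↦ mod_cast (Nat.lt_pow_self (by simp)).le)
  refine mul_neg_of_neg_of_pos (by simp) (Real.log_pos ?_)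
  rw [one_sub_three_quarters]
  norm_num [ENNReal.toReal_div]

lemma half_lt_three_quarters : (2 : ENNReal)⁻¹ < 3 / 4 := by
  rw [← ENNReal.toReal_lt_toReal (by finiteness) (by finiteness)]
  norm_num [ENNReal.toReal_div]

lemma logRatio_three_quarters_pos : 0 < Fernique.logRatio (3 / 4) := by
  refine Fernique.logRatio_pos half_lt_three_quarters ?_
  rw [← ENNReal.toReal_lt_toReal (by finiteness) (by finiteness)]
  norm_num [ENNReal.toReal_div]

section Field

variable {Ω : Type*} [MeasurableSpace Ω] {P : Measure Ω}

lemma IsCenteredGaussianField.isCenteredGaussianRV {T : Type*} {X : T → Ω → ℝ}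
    (hX : IsCenteredGaussianField P X) (t : T) : IsCenteredGaussianRV P (X t) := by
  simpa using hX.2 1 (fun _ => 1) (fun _ => t)

lemma IsCenteredGaussianField.sub {T : Type*} {X : T → Ω → ℝ}
    (hX : IsCenteredGaussianField P X) {S : Type*} (p q : S → T) :
    IsCenteredGaussianField P (fun r ω => X (p r) ω - X (q r) ω) := by
  refine ⟨fun r => (hX.1 _).sub (hX.1 _), fun k c t => ?_⟩
  convert hX.2 (k + k) (Fin.append c (fun i => -c i))
    (Fin.append (fun i => p (t i)) (fun i => q (t i))) using 2 with ω
  simp only [Fin.sum_univ_add, Fin.append_left, Fin.append_right, mul_sub, neg_mul,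
    Finset.sum_sub_distrib, Finset.sum_neg_distrib, ← sub_eq_add_neg]

end Field

section Fernique

variable {Ω : Type*} [MeasurableSpace Ω] {P : Measure Ω} [IsProbabilityMeasure P]

/-- Quantitative Fernique bound for finitely many jointly Gaussian variables. -/
lemma measureReal_norm_gt_le_of_gaussian {N : ℕ} {X : Fin N → Ω → ℝ}
    (hX : ∀ i, Measurable (X i))
    (hgauss : ∀ c : Fin N → ℝ, IsCenteredGaussianRV P (fun ω => ∑ i, c i * X i ω))
    {s : ℝ} (hs : 3 / 4 ≤ P {ω | ‖fun i => X i ω‖ ≤ s}) {τ : ℝ} (hτ : 0 ≤ τ) :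
    P.real {ω | τ < ‖fun i => X i ω‖}
      ≤ ferniqueConst.toReal * rexp (-(Fernique.logRatio (3 / 4) * s⁻¹ ^ 2 * τ ^ 2)) := by
  have hXm : Measurable (fun ω i => X i ω) := measurable_pi_lambda _ hX
  set μ := P.map (fun ω i => X i ω) with hμ
  have : IsProbabilityMeasure μ := Measure.isProbabilityMeasure_map hXm.aemeasurable
  have hL (L : (Fin N → ℝ) →L[ℝ] ℝ) : ∃ v : NNReal, μ.map L = gaussianReal 0 v := by
    obtain ⟨v, hv⟩ := hgauss (fun i => L (fun j => if i = j then 1 else 0))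
    refine ⟨v, ?_⟩
    rw [hμ, Measure.map_map (by fun_prop) hXm, ← hv]
    congr 1
    ext ω
    have := L.toLinearMap.pi_apply_eq_sum_univ (fun i => X i ω)
    simp only [ContinuousLinearMap.coe_coe, smul_eq_mul] at this
    simp only [Function.comp_apply, this, mul_comm]
  have : IsGaussian μ := isGaussian_of_map_eq_gaussianReal fun L => ⟨0, hL L⟩
  have hrot : (μ.prod μ).map (ContinuousLinearMap.rotation (-(π / 4))) = μ.prod μ := by
    refine IsGaussian.map_rotation_eq_self_of_forall_strongDual_eq_zero (fun L => ?_) _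
    obtain ⟨v, hv⟩ := hL L
    have : ∫ x, L x ∂μ = ∫ y, y ∂(μ.map L) := by
      rw [integral_map L.continuous.aemeasurable (by fun_prop)]
    rw [this, hv, integral_id_gaussianReal]
  have hset (p : ℝ → Prop) (hp : MeasurableSet {x | p x}) :
      μ {x | p ‖x‖} = P {ω | p ‖fun i => X i ω‖} := by
    exact Measure.map_apply hXm (measurable_norm hp)
  have hint := lintegral_exp_mul_sq_norm_le_of_map_rotation_eq_self hrot
    (hs.trans_eq (hset (· ≤ s) measurableSet_Iic).symm) half_lt_three_quarters
  have hmarkov := (mul_meas_ge_le_lintegral (μ := μ)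
    (f := fun x => .ofReal (rexp (Fernique.logRatio (3 / 4) * s⁻¹ ^ 2 * ‖x‖ ^ 2))) (by fun_prop)
    (.ofReal (rexp (Fernique.logRatio (3 / 4) * s⁻¹ ^ 2 * τ ^ 2)))).trans hint
  have hle : P {ω | τ < ‖fun i => X i ω‖}
      ≤ μ {x | ENNReal.ofReal (rexp (Fernique.logRatio (3 / 4) * s⁻¹ ^ 2 * τ ^ 2))
        ≤ .ofReal (rexp (Fernique.logRatio (3 / 4) * s⁻¹ ^ 2 * ‖x‖ ^ 2))} := by
    rw [← hset (τ < ·) measurableSet_Ioi]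
    refine measure_mono fun x hx => ?_
    have := logRatio_three_quarters_pos
    have hx : τ < ‖x‖ := hx
    simp only [mem_ofPred_eq]
    gcongr
  have h1 := ENNReal.toReal_mono ferniqueConst_ne_top ((mul_le_mul_right hle _).trans hmarkov)
  rw [ENNReal.toReal_mul, ENNReal.toReal_ofReal (exp_pos _).le] at h1
  rw [exp_neg, ← div_eq_mul_inv, le_div_iff₀ (exp_pos _), mul_comm]
  exact h1

/-- Quantitative Fernique bound for the supremum of a continuous Gaussian field. -/
lemma IsCenteredGaussianField.measureReal_exists_gt_le {T : Type*} [TopologicalSpace T]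
    [TopologicalSpace.SeparableSpace T] [Nonempty T] {X : T → Ω → ℝ}
    (hX : IsCenteredGaussianField P X) (hcont : ∀ᵐ ω ∂P, Continuous fun t => X t ω)
    {s : ℝ} (hs0 : 0 ≤ s) (hs : 3 / 4 ≤ P {ω | ∀ t, |X t ω| ≤ s}) {τ : ℝ} (hτ : 0 ≤ τ) :
    P.real {ω | ∃ t, τ < |X t ω|}
      ≤ ferniqueConst.toReal * rexp (-(Fernique.logRatio (3 / 4) * s⁻¹ ^ 2 * τ ^ 2)) := by
  let d := TopologicalSpace.denseSeq T
  let A : ℕ → Set Ω := fun N => {ω | τ < ‖fun i : Fin N => X (d i) ω‖}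
  have hmem (N : ℕ) (ω : Ω) : ω ∈ A N ↔ ∃ i < N, τ < |X (d i) ω| := by
    simp only [A, mem_ofPred_eq]
    rw [← not_le, pi_norm_le_iff_of_nonneg hτ]
    simp only [not_forall, not_le, Real.norm_eq_abs]
    exact ⟨fun ⟨i, hi⟩ => ⟨i, i.2, hi⟩, fun ⟨i, hi, h⟩ => ⟨⟨i, hi⟩, h⟩⟩
  have hmono : Monotone A := fun m n hmn ω hω => by
    rw [hmem] at hω ⊢
    obtain ⟨i, hi, h⟩ := hω
    exact ⟨i, hi.trans_le hmn, h⟩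
  have hle (N : ℕ) : P.real (A N)
      ≤ ferniqueConst.toReal * rexp (-(Fernique.logRatio (3 / 4) * s⁻¹ ^ 2 * τ ^ 2)) := by
    refine measureReal_norm_gt_le_of_gaussian (fun i => hX.1 _) (fun c => hX.2 N c _) ?_ hτ
    refine hs.trans (measure_mono fun ω hω => ?_)
    exact (pi_norm_le_iff_of_nonneg hs0).2 fun i => hω _
  have hlim : Tendsto (fun N => P.real (A N)) atTop (nhds (P.real (⋃ N, A N))) :=
    (ENNReal.tendsto_toReal (measure_ne_top _ _)).comp (tendsto_measure_iUnion_atTop hmono)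
  refine le_trans ?_ (le_of_tendsto' hlim hle)
  refine ENNReal.toReal_mono (measure_ne_top _ _) (measure_mono_ae ?_)
  filter_upwards [hcont] with ω hω hex
  have hopen : IsOpen {t | τ < |X t ω|} := isOpen_lt continuous_const hω.abs
  obtain ⟨i, hi⟩ := (TopologicalSpace.denseRange_denseSeq T).exists_mem_open hopen hex
  exact mem_iUnion.2 ⟨i + 1, (hmem _ _).2 ⟨i, by simp, hi⟩⟩

lemma exists_three_quarters_le_measure {A : ℕ → Set Ω} (hmono : Monotone A)
    (hA : ∀ᵐ ω ∂P, ∃ k, ω ∈ A k) : ∃ k, 3 / 4 ≤ P (A k) := by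
  have hlim := tendsto_measure_iUnion_atTop (μ := P) hmono
  have h1 : P (⋃ k, A k) = 1 := by
    rw [← measure_univ (μ := P)]
    refine measure_congr ?_
    filter_upwards [hA] with ω hω
    exact eq_true (mem_iUnion.2 hω) |>.trans (eq_true (mem_univ ω)).symm
  rw [h1] at hlim
  have hlt : (3 / 4 : ENNReal) < 1 := by
    rw [← ENNReal.toReal_lt_toReal (by finiteness) (by finiteness)]
    norm_num [ENNReal.toReal_div]
  obtain ⟨k, hk⟩ := (hlim.eventually (lt_mem_nhds hlt)).exists
  exact ⟨k, hk.le⟩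

/-- The supremum of a continuous Gaussian field on a compact space has Gaussian tails. -/
lemma IsCenteredGaussianField.exists_tail_bound {T : Type*} [TopologicalSpace T]
    [TopologicalSpace.SeparableSpace T] [CompactSpace T] [Nonempty T] {X : T → Ω → ℝ}
    (hX : IsCenteredGaussianField P X) (hcont : ∀ᵐ ω ∂P, Continuous fun t => X t ω) :
    ∃ c : ℝ, 0 < c ∧ ∀ τ : ℝ, 0 ≤ τ →
      P.real {ω | ∃ t, τ < |X t ω|} ≤ ferniqueConst.toReal * rexp (-(c * τ ^ 2)) := by
  obtain ⟨k, hk⟩ := exists_three_quarters_le_measure (P := P)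
    (A := fun k : ℕ => {ω | ∀ t, |X t ω| ≤ k + 1})
    (fun m n hmn ω hω t => (hω t).trans (by gcongr)) (by
      filter_upwards [hcont] with ω hω
      obtain ⟨C, hC⟩ := isCompact_univ.exists_bound_of_continuousOn hω.continuousOn
      obtain ⟨k, hk⟩ := exists_nat_ge C
      exact ⟨k, fun t => (hC t trivial).trans (hk.trans (by simp))⟩)
  refine ⟨Fernique.logRatio (3 / 4) * ((k : ℝ) + 1)⁻¹ ^ 2, ?_, fun τ hτ =>
    hX.measureReal_exists_gt_le hcont (by positivity) hk hτ⟩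
  have := logRatio_three_quarters_pos
  positivity

/-- A continuous Gaussian field on a compact metric space has small increments on close points,
with large probability. -/
lemma exists_three_quarters_le_measure_increments {M : Type*} [PseudoMetricSpace M]
    [CompactSpace M] {X : M → Ω → ℝ} (hcont : ∀ᵐ ω ∂P, Continuous fun t => X t ω)
    {s : ℝ} (hs : 0 < s) :
    ∃ r : ℝ, 0 < r ∧
      3 / 4 ≤ P {ω | ∀ p : {p : M × M // dist p.1 p.2 ≤ r}, |X p.1.1 ω - X p.1.2 ω| ≤ s} := by
  obtain ⟨k, hk⟩ := exists_three_quarters_le_measure (P := P)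
    (A := fun k : ℕ => {ω | ∀ p : {p : M × M // dist p.1 p.2 ≤ 1 / ((k : ℝ) + 1)},
      |X p.1.1 ω - X p.1.2 ω| ≤ s})
    (fun m n hmn ω hω p => hω ⟨p.1, p.2.trans (by gcongr)⟩) (by
      filter_upwards [hcont] with ω hω
      obtain ⟨r, hr, h⟩ := Metric.uniformContinuous_iff.1
        (CompactSpace.uniformContinuous_of_continuous hω) s hs
      obtain ⟨k, hk⟩ := exists_nat_one_div_lt hr
      exact ⟨k, fun p => (h (p.2.trans_lt hk)).le⟩)
  exact ⟨_, by positivity, hk⟩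

end Fernique

section OneDimensional

variable {Ω : Type*} [MeasurableSpace Ω] {P : Measure Ω} {Y : Ω → ℝ} {v : NNReal}

lemma integral_sq_of_map_eq_gaussianReal (hY : Measurable Y) (hv : P.map Y = gaussianReal 0 v) :
    ∫ ω, Y ω ^ 2 ∂P = v := by
  have h1 : ∫ ω, Y ω ^ 2 ∂P = ∫ y, y ^ 2 ∂(P.map Y) := by
    rw [integral_map hY.aemeasurable (by fun_prop)]
  have h2 := variance_fun_id_gaussianReal (μ := 0) (v := v)
  rw [variance_of_integral_eq_zero (by fun_prop) integral_id_gaussianReal] at h2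
  rw [h1, hv, h2]

lemma measureReal_le_abs_le_of_gaussian [IsProbabilityMeasure P] (hY : Measurable Y)
    (hgauss : IsCenteredGaussianRV P Y) {σsq : ℝ} (hσ : 0 < σsq)
    (hle : ∫ ω, Y ω ^ 2 ∂P ≤ σsq) {τ : ℝ} (hτ : 0 ≤ τ) :
    P.real {ω | τ ≤ |Y ω|} ≤ 2 * rexp (-(τ ^ 2 / (2 * σsq))) := by
  obtain ⟨v, hv⟩ := hgauss
  rw [integral_sq_of_map_eq_gaussianReal hY hv] at hle
  have hsub : HasSubgaussianMGF Y ⟨σsq, hσ.le⟩ P := by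
    refine ⟨fun t => ?_, fun t => ?_⟩
    · have := integrable_exp_mul_gaussianReal (μ := 0) (v := v) t
      rw [← hv] at this
      exact this.comp_measurable hY
    · rw [mgf_gaussianReal hv]
      simp only [zero_mul, zero_add]
      gcongr
      exact hle
  have h1 : P.real {ω | τ ≤ Y ω} ≤ rexp (-τ ^ 2 / (2 * σsq)) := hsub.measure_ge_le hτ
  have h2 : P.real {ω | τ ≤ (-Y) ω} ≤ rexp (-τ ^ 2 / (2 * σsq)) := hsub.neg.measure_ge_le hτ
  have hsplit : {ω | τ ≤ |Y ω|} ⊆ {ω | τ ≤ Y ω} ∪ {ω | τ ≤ (-Y) ω} := by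
    intro ω hω
    rcases le_abs.1 (show τ ≤ |Y ω| from hω) with h | h
    exacts [.inl h, .inr h]
  have h3 := (measureReal_mono (μ := P) hsplit).trans (measureReal_union_le _ _)
  rw [neg_div] at h1 h2
  linarith

lemma le_measureReal_gt_of_gaussian (hY : Measurable Y)
    (hv : P.map Y = gaussianReal 0 v) (hv0 : v ≠ 0) {s : ℝ} (hs : 0 ≤ s) :
    (√(2 * π * v))⁻¹ * rexp (-((s + 1) ^ 2 / (2 * v))) ≤ P.real {ω | s < Y ω} := by
  have h1 : P.real {ω | s < Y ω} = (gaussianReal 0 v).real (Ioi s) := by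
    rw [← hv, map_measureReal_apply hY measurableSet_Ioi]
    rfl
  have h2 : ∫ x in Ioc s (s + 1), gaussianPDFReal 0 v x = (gaussianReal 0 v).real (Ioc s (s + 1)) := by
    rw [measureReal_def, gaussianReal_apply_eq_integral _ hv0, ENNReal.toReal_ofReal]
    exact integral_nonneg fun x => gaussianPDFReal_nonneg _ _ _
  have h3 := setIntegral_ge_of_const_le_real (μ := volume) (s := Ioc s (s + 1))
    (c := (√(2 * π * v))⁻¹ * rexp (-((s + 1) ^ 2 / (2 * v)))) (f := gaussianPDFReal 0 v)
    measurableSet_Ioc (by simp) (fun x hx => by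
      rw [gaussianPDFReal_def]
      have : 0 < (v : ℝ) := by positivity
      have h0 : 0 ≤ x := hs.trans hx.1.le
      have := hx.2
      simp only [sub_zero, neg_div]
      gcongr) (integrable_gaussianPDFReal 0 v).integrableOn
  simp only [Real.volume_real_Ioc_of_le (le_add_of_nonneg_right zero_le_one),
    add_sub_cancel_left, mul_one] at h3
  rw [h1]
  exact h3.trans (h2.le.trans (measureReal_mono Ioc_subset_Ioi_self))

end OneDimensional

section SharpTail

variable {Ω : Type*} [MeasurableSpace Ω] {P : Measure Ω} [IsProbabilityMeasure P]

/-- Sharp exponential rate for the upper tail of the supremum of a continuous Gaussian field. -/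
lemma IsCenteredGaussianField.exists_sharp_tail_bound {M : Type*} [PseudoMetricSpace M]
    [CompactSpace M] [Nonempty M] {X : M → Ω → ℝ}
    (hX : IsCenteredGaussianField P X) (hcont : ∀ᵐ ω ∂P, Continuous fun t => X t ω)
    {σsq : ℝ} (hσ : 0 < σsq) (hle : ∀ t, ∫ ω, X t ω ^ 2 ∂P ≤ σsq)
    {η : ℝ} (hη : 0 < η) (hη1 : η < 1) :
    ∃ B : ℝ, 0 ≤ B ∧ ∀ τ : ℝ, 0 ≤ τ →
      P.real {ω | ∃ t, τ < |X t ω|} ≤ B * rexp (-((1 - η) ^ 2 * τ ^ 2 / (2 * σsq))) := by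
  have hκ := logRatio_three_quarters_pos
  set κ := Fernique.logRatio (3 / 4)
  set s := η * √(2 * σsq * κ) with hs
  have hs0 : 0 < s := by positivity
  have hss : κ * s⁻¹ ^ 2 * η ^ 2 = 1 / (2 * σsq) := by
    rw [hs, inv_pow, mul_pow, Real.sq_sqrt (by positivity)]
    field_simp
  obtain ⟨r, hr, hincr⟩ := exists_three_quarters_le_measure_increments hcont hs0
  obtain ⟨F, -, hFfin, hF⟩ := finite_cover_balls_of_compact (isCompact_univ (X := M)) hr
  lift F to Finset M using hFfin
  have : Nonempty {p : M × M // dist p.1 p.2 ≤ r} :=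
    ⟨⟨(Classical.arbitrary M, Classical.arbitrary M), by simpa using hr.le⟩⟩
  have htail (τ : ℝ) (hτ : 0 ≤ τ) := (hX.sub
    (fun p : {p : M × M // dist p.1 p.2 ≤ r} => p.1.1) (fun p => p.1.2)).measureReal_exists_gt_le
    (by filter_upwards [hcont] with ω hω; fun_prop) hs0.le hincr (τ := η * τ) (by positivity)
  refine ⟨F.card * 2 + ferniqueConst.toReal, by positivity, fun τ hτ => ?_⟩
  have hsplit : {ω | ∃ t, τ < |X t ω|} ⊆ (⋃ y ∈ F, {ω | (1 - η) * τ ≤ |X y ω|}) ∪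
      {ω | ∃ p : {p : M × M // dist p.1 p.2 ≤ r}, η * τ < |X p.1.1 ω - X p.1.2 ω|} := by
    rintro ω ⟨t, ht⟩
    obtain ⟨y, hy, hty⟩ := mem_iUnion₂.1 (hF (mem_univ t))
    by_cases h : (1 - η) * τ ≤ |X y ω|
    · exact .inl (mem_iUnion₂.2 ⟨y, hy, h⟩)
    · refine .inr ⟨⟨(t, y), (Metric.mem_ball.1 hty).le⟩, ?_⟩
      have := abs_sub_abs_le_abs_sub (X t ω) (X y ω)
      simp only
      linarith
  have hexp : rexp (-(κ * s⁻¹ ^ 2 * (η * τ) ^ 2))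
      ≤ rexp (-((1 - η) ^ 2 * τ ^ 2 / (2 * σsq))) := by
    have : κ * s⁻¹ ^ 2 * (η * τ) ^ 2 = 1 * τ ^ 2 / (2 * σsq) := by
      rw [mul_pow, ← mul_assoc, hss]; ring
    rw [this]
    gcongr
    nlinarith
  calc P.real {ω | ∃ t, τ < |X t ω|}
    _ ≤ P.real (⋃ y ∈ F, {ω | (1 - η) * τ ≤ |X y ω|}) + P.real
        {ω | ∃ p : {p : M × M // dist p.1 p.2 ≤ r}, η * τ < |X p.1.1 ω - X p.1.2 ω|} :=
      (measureReal_mono hsplit).trans (measureReal_union_le _ _)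
    _ ≤ ∑ y ∈ F, 2 * rexp (-((1 - η) ^ 2 * τ ^ 2 / (2 * σsq)))
        + ferniqueConst.toReal * rexp (-((1 - η) ^ 2 * τ ^ 2 / (2 * σsq))) := by
      refine add_le_add ((measureReal_biUnion_finset_le _ _).trans (Finset.sum_le_sum fun y _ => ?_))
        ((htail τ hτ).trans (by gcongr))
      rw [← mul_pow]
      exact measureReal_le_abs_le_of_gaussian (hX.1 y) (hX.isCenteredGaussianRV y) hσ (hle y)
        (mul_nonneg (by linarith) hτ)
    _ = _ := by
      rw [Finset.sum_const, nsmul_eq_mul]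
      ring

end SharpTail

/-- The difference of Branson curvatures under a conformal change with factor `e^{2af}`. -/
noncomputable def bransonCurvatureChange (n a q f h : ℝ) : ℝ :=
  q * (rexp (-n * a * f) - 1) + a * rexp (-n * a * f) * h

section Linearization

variable {n a K R u : ℝ}

lemma abs_bransonCurvatureChange_sub_le {q f h : ℝ} (hn : 0 ≤ n) (ha : 0 ≤ a) (hq : |q| ≤ K)
    (hf : |f| ≤ R) (hh : |h| ≤ R) (hR : n * (a * R) ≤ 1) :
    |bransonCurvatureChange n a q f h - a * (h - n * q * f)|
      ≤ (K * n ^ 2 + 2 * n) * (a * R) ^ 2 := by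
  set z := -n * a * f with hz
  have hR0 : 0 ≤ R := (abs_nonneg f).trans hf
  have hzle : |z| ≤ n * (a * R) := by
    rw [hz, abs_mul, abs_mul, abs_neg, abs_of_nonneg hn, abs_of_nonneg ha, mul_assoc]
    gcongr
  have h1 := Real.abs_exp_sub_one_sub_id_le (hzle.trans hR)
  have h2 := Real.abs_exp_sub_one_le (hzle.trans hR)
  have hz2 : z ^ 2 ≤ (n * (a * R)) ^ 2 := by
    rw [← sq_abs]
    gcongr
  have heq : bransonCurvatureChange n a q f h - a * (h - n * q * f)
      = q * (rexp z - 1 - z) + a * h * (rexp z - 1) := by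
    rw [bransonCurvatureChange, ← hz, hz]
    ring
  calc |bransonCurvatureChange n a q f h - a * (h - n * q * f)|
    _ ≤ |q| * |rexp z - 1 - z| + a * |h| * |rexp z - 1| := by
      rw [heq]
      refine (abs_add_le _ _).trans_eq ?_
      rw [abs_mul, abs_mul, abs_mul, abs_of_nonneg ha]
    _ ≤ K * (n * (a * R)) ^ 2 + a * R * (2 * (n * (a * R))) := by
      have hK : 0 ≤ K := (abs_nonneg q).trans hq
      gcongr
      · exact h1.trans hz2
      · exact h2.trans (by gcongr)
    _ = _ := by ring

variable {M : Type*} {q f h : M → ℝ} {η : ℝ}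

lemma exists_lt_abs_linearization [Nonempty M] (hn : 0 ≤ n) (ha : 0 < a) (hq : ∀ x, |q x| ≤ K)
    (hf : ∀ x, |f x| ≤ R) (hh : ∀ x, |h x| ≤ R) (hR : n * (a * R) ≤ 1)
    (hη : (K * n ^ 2 + 2 * n) * (a * R) ^ 2 ≤ η * u)
    (hu : u < ⨆ x, |bransonCurvatureChange n a (q x) (f x) (h x)|) :
    ∃ x, (1 - η) * (u / a) < |h x - n * q x * f x| := by
  obtain ⟨x, hx⟩ := exists_lt_of_lt_ciSup hu
  refine ⟨x, ?_⟩
  have h1 := abs_bransonCurvatureChange_sub_le hn ha.le (hq x) (hf x) (hh x) hR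
  have h2 := abs_sub_abs_le_abs_sub (bransonCurvatureChange n a (q x) (f x) (h x))
    (a * (h x - n * q x * f x))
  rw [abs_mul, abs_of_pos ha] at h2
  rw [← mul_div_assoc, div_lt_iff₀ ha]
  linarith

lemma lt_iSup_abs_bransonCurvatureChange (hn : 0 ≤ n) (ha : 0 < a) (hq : ∀ x, |q x| ≤ K)
    (hf : ∀ x, |f x| ≤ R) (hh : ∀ x, |h x| ≤ R) (hR : n * (a * R) ≤ 1)
    (hη : (K * n ^ 2 + 2 * n) * (a * R) ^ 2 ≤ η * u) {x₀ : M}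
    (hx₀ : (1 + η) * (u / a) < h x₀ - n * q x₀ * f x₀) :
    u < ⨆ x, |bransonCurvatureChange n a (q x) (f x) (h x)| := by
  have h1 (x : M) := abs_bransonCurvatureChange_sub_le hn ha.le (hq x) (hf x) (hh x) hR
  have hbdd : BddAbove (range fun x => |bransonCurvatureChange n a (q x) (f x) (h x)|) := by
    refine ⟨η * u + a * (R + n * K * R), ?_⟩
    rintro _ ⟨x, rfl⟩
    have hK : 0 ≤ K := (abs_nonneg _).trans (hq x)
    have h2 := abs_sub_abs_le_abs_sub (bransonCurvatureChange n a (q x) (f x) (h x))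
      (a * (h x - n * q x * f x))
    have h3 : |a * (h x - n * q x * f x)| ≤ a * (R + n * K * R) := by
      rw [abs_mul, abs_of_pos ha]
      gcongr
      refine (abs_sub _ _).trans (add_le_add (hh x) ?_)
      rw [abs_mul, abs_mul, abs_of_nonneg hn]
      gcongr
      exacts [hq x, hf x]
    have := h1 x
    simp only
    linarith
  refine lt_of_lt_of_le ?_ (le_ciSup hbdd x₀)
  refine lt_of_lt_of_le ?_ (le_abs_self _)
  have h2 := (abs_le.1 (h1 x₀)).1
  rw [← mul_div_assoc, div_lt_iff₀ ha] at hx₀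
  linarith

end Linearization

lemma log_div_neg_mem_Ioo {p N ε b B : ℝ} (hN : 0 < N) (hb : 0 < b) (hB : 0 < B)
    (hlb : |Real.log b| < ε / 2 * N) (hlB : |Real.log B| < ε / 2 * N)
    (hlow : b * rexp (-((1 + ε / 2) * N)) ≤ p) (hupp : p ≤ B * rexp (-((1 - ε / 2) * N))) :
    Real.log p / (-N) ∈ Ioo (1 - ε) (1 + ε) := by
  have hlow' := Real.log_le_log (by positivity) hlow
  have hp : 0 < p := lt_of_lt_of_le (by positivity) hlow
  have hupp' := Real.log_le_log hp hupp
  rw [Real.log_mul (by positivity) (by positivity), Real.log_exp] at hlow' hupp'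
  have h1 := (abs_lt.1 hlb).1
  have h2 := (abs_lt.1 hlB).2
  rw [div_neg, ← neg_div]
  constructor
  · rw [lt_div_iff₀ hN]
    linarith
  · rw [div_lt_iff₀ hN]
    linarith

section Pair

variable {Ω T : Type*} [MeasurableSpace Ω] [MeasurableSpace T] {P : Measure Ω} {f h : Ω × T → ℝ}

lemma IsJointlyCenteredGaussianPair.isCenteredGaussianField
    (hfh : IsJointlyCenteredGaussianPair P f h) (α β : T → ℝ) :
    IsCenteredGaussianField P (fun x ω => α x * h (ω, x) - β x * f (ω, x)) := by
  obtain ⟨hf, hh, hgauss⟩ := hfh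
  refine ⟨fun x => by fun_prop, fun k c t => ?_⟩
  convert hgauss k (fun i => -(c i * β (t i))) (fun i => c i * α (t i)) t t using 4 with ω i
  ring

end Pair

section ExponentialEstimates

lemma le_sub_two_mul_exp {b A σ η ε t : ℝ} (hb : 0 < b) (hσ : 0 < σ) (hη : 0 < η)
    (hη1 : η ≤ 1 / 2) (hηε : η ≤ ε / 16) (ht : 1 ≤ t) (htη : 1 / η ≤ t) (htA : 4 * A / b ≤ t) :
    b / 2 * rexp (-((1 + ε / 2) * (1 / (2 * σ) * t ^ 2)))
      ≤ b * rexp (-(((1 + η) * t + 1) ^ 2 / (2 * σ)))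
        - 2 * (A * rexp (-(((1 + 2 * η) ^ 2 * (1 / (2 * σ)) + 1) * t ^ 2))) := by
  have hηt : 1 ≤ η * t := by rwa [← div_le_iff₀' hη]
  have h2 : rexp (-((1 + 2 * η) ^ 2 * (1 / (2 * σ)) * t ^ 2))
      ≤ rexp (-(((1 + η) * t + 1) ^ 2 / (2 * σ))) := by
    have : (1 + 2 * η) ^ 2 * (1 / (2 * σ)) * t ^ 2 = ((1 + 2 * η) * t) ^ 2 / (2 * σ) := by ring
    rw [this]
    gcongr
    linarith
  have h3 : 2 * A * rexp (-t ^ 2) ≤ b / 2 := by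
    have h4 : 4 * A / b ≤ rexp (t ^ 2) := by
      have := Real.add_one_le_exp (t ^ 2)
      nlinarith
    rw [div_le_iff₀ hb] at h4
    rw [exp_neg, ← div_eq_mul_inv, div_le_iff₀ (exp_pos _)]
    linarith
  have h5 : rexp (-(((1 + 2 * η) ^ 2 * (1 / (2 * σ)) + 1) * t ^ 2))
      = rexp (-((1 + 2 * η) ^ 2 * (1 / (2 * σ)) * t ^ 2)) * rexp (-t ^ 2) := by
    rw [← exp_add]
    ring_nf
  have h6 : rexp (-((1 + ε / 2) * (1 / (2 * σ) * t ^ 2)))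
      ≤ rexp (-((1 + 2 * η) ^ 2 * (1 / (2 * σ)) * t ^ 2)) := by
    rw [mul_assoc ((1 + 2 * η) ^ 2)]
    gcongr
    nlinarith
  have h7 := mul_le_mul_of_nonneg_left h6 (half_pos hb).le
  have h8 := mul_le_mul_of_nonneg_left h2 hb.le
  have h9 := mul_le_mul_of_nonneg_right h3
    (exp_pos (-((1 + 2 * η) ^ 2 * (1 / (2 * σ)) * t ^ 2))).le
  rw [h5]
  linarith

lemma two_mul_add_exp_le {A B σ η ε t : ℝ} (hA : 0 ≤ A) (hB : 0 ≤ B) (hσ : 0 < σ) (hη : 0 < η)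
    (hη1 : η ≤ 1 / 2) (hηε : η ≤ ε / 16) :
    2 * (A * rexp (-(((1 + 2 * η) ^ 2 * (1 / (2 * σ)) + 1) * t ^ 2)))
        + B * rexp (-((1 - η) ^ 2 * ((1 - η) * t) ^ 2 / (2 * σ)))
      ≤ (2 * A + B + 1) * rexp (-((1 - ε / 2) * (1 / (2 * σ) * t ^ 2))) := by
  have h2 : rexp (-((1 - η) ^ 2 * ((1 - η) * t) ^ 2 / (2 * σ)))
      ≤ rexp (-((1 - ε / 2) * (1 / (2 * σ) * t ^ 2))) := by
    have : (1 - η) ^ 2 * ((1 - η) * t) ^ 2 / (2 * σ) = (1 - η) ^ 4 * (1 / (2 * σ) * t ^ 2) := by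
      ring
    rw [this]
    gcongr
    have := one_add_mul_le_pow (a := -η) (by linarith) 4
    norm_num [← sub_eq_add_neg] at this
    linarith
  have h3 : rexp (-(((1 + 2 * η) ^ 2 * (1 / (2 * σ)) + 1) * t ^ 2))
      ≤ rexp (-((1 - ε / 2) * (1 / (2 * σ) * t ^ 2))) := by
    have hL : 0 < 1 / (2 * σ) := by positivity
    have hcoef : 1 - ε / 2 ≤ (1 + 2 * η) ^ 2 := by nlinarith
    rw [← mul_assoc]
    gcongr
    linarith [mul_le_mul_of_nonneg_right hcoef hL.le]
  have h4 := mul_le_mul_of_nonneg_left h3 hA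
  have h5 := mul_le_mul_of_nonneg_left h2 hB
  have h6 := exp_pos (-((1 - ε / 2) * (1 / (2 * σ) * t ^ 2)))
  linarith

end ExponentialEstimates

/-- Paper: L^∞ bound for Q-curvature (Section 7.6).  With `w = h − n Q₀ f` and
`D(a) = Q₀ (e^{−naf} − 1) + a e^{−naf} h` (`= Q₁ − Q₀`), in the regime
`a → 0`, `u → 0`, `u/a → ∞`, one has `log Prob{‖D(a)‖_∞ > u} ∼ −u²/(2a²σ_w²)`. -/
theorem stmt_17 {Ω M : Type*} [MeasurableSpace Ω] [MetricSpace M] [CompactSpace M] [Nonempty M]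
    [MeasurableSpace M] [BorelSpace M]
    (P : Measure Ω) [IsProbabilityMeasure P]
    (n : ℕ) (hn : 0 < n) (hneven : Even n)
    (Q₀ : M → ℝ) (hQ₀ : Continuous Q₀)
    (f h : Ω × M → ℝ)
    (hgauss : IsJointlyCenteredGaussianPair P f h)
    (hfcont : ∀ᵐ ω ∂P, Continuous fun x => f (ω, x))
    (hhcont : ∀ᵐ ω ∂P, Continuous fun x => h (ω, x))
    (Cf : ℝ) (hCf : ∀ x : M, (∫ ω, f (ω, x) ^ 2 ∂P) ≤ Cf)
    (Ch : ℝ) (hCh : ∀ x : M, (∫ ω, h (ω, x) ^ 2 ∂P) ≤ Ch)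
    (σwsq : ℝ) (hσpos : 0 < σwsq)
    (hub : ∀ x : M, (∫ ω, (h (ω, x) - (n : ℝ) * Q₀ x * f (ω, x)) ^ 2 ∂P) ≤ σwsq)
    (hatt : ∃ x₀ : M, (∫ ω, (h (ω, x₀) - (n : ℝ) * Q₀ x₀ * f (ω, x₀)) ^ 2 ∂P) = σwsq) :
    ∀ ε : ℝ, 0 < ε → ∃ δ : ℝ, 0 < δ ∧ ∀ a u : ℝ, 0 < a → 0 < u → u < δ → 1 / δ < u / a →
      Real.log
          (P {ω | u < ⨆ x : M,
            |Q₀ x * (Real.exp (-(n : ℝ) * a * f (ω, x)) - 1)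
              + a * Real.exp (-(n : ℝ) * a * f (ω, x)) * h (ω, x)|}).toReal
        / (-u ^ 2 / (2 * a ^ 2 * σwsq)) ∈ Set.Ioo (1 - ε) (1 + ε) := by
  have hσL : 0 < 1 / (2 * σwsq) := by positivity
  set L := 1 / (2 * σwsq) with hL
  obtain ⟨K, hK⟩ : ∃ K, ∀ x, |Q₀ x| ≤ K := by
    obtain ⟨K, hK⟩ := isCompact_univ.exists_bound_of_continuousOn hQ₀.continuousOn
    exact ⟨K, fun x => hK x trivial⟩
  have hK0 : 0 ≤ K := (abs_nonneg _).trans (hK (Classical.arbitrary M))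
  have hn0 : (0 : ℝ) < n := by exact_mod_cast hn
  set w : M → Ω → ℝ := fun x ω => h (ω, x) - (n : ℝ) * Q₀ x * f (ω, x)
  have hfield : IsCenteredGaussianField P (fun x ω => f (ω, x)) := by
    simpa using hgauss.isCenteredGaussianField (fun _ => 0) (fun _ => -1)
  have hhfield : IsCenteredGaussianField P (fun x ω => h (ω, x)) := by
    simpa using hgauss.isCenteredGaussianField (fun _ => 1) (fun _ => 0)
  have hwfield : IsCenteredGaussianField P w := by
    simpa using hgauss.isCenteredGaussianField (fun _ => 1) (fun x => n * Q₀ x)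
  have hwcont : ∀ᵐ ω ∂P, Continuous fun x => w x ω := by
    filter_upwards [hfcont, hhcont] with ω h1 h2
    exact h2.sub ((continuous_const.mul hQ₀).mul h1)
  obtain ⟨cf, hcf, hftail⟩ := hfield.exists_tail_bound hfcont
  obtain ⟨ch, hch, hhtail⟩ := hhfield.exists_tail_bound hhcont
  set A := ferniqueConst.toReal
  have hA : 0 ≤ A := ENNReal.toReal_nonneg
  obtain ⟨x₀, hx₀⟩ := hatt
  obtain ⟨v, hv⟩ := hwfield.isCenteredGaussianRV x₀
  have hvσ : (v : ℝ) = σwsq := by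
    rw [← hx₀, ← integral_sq_of_map_eq_gaussianReal (hwfield.1 x₀) hv]
  have hv0 : v ≠ 0 := by
    rintro rfl
    simp at hvσ
    linarith
  have hlower (s : ℝ) (hs : 0 ≤ s) := le_measureReal_gt_of_gaussian (hwfield.1 x₀) hv hv0 hs
  rw [hvσ] at hlower
  have hb : 0 < (√(2 * π * σwsq))⁻¹ := by positivity
  set b := (√(2 * π * σwsq))⁻¹
  intro ε hε
  obtain ⟨η, hη, hη1, hηε⟩ : ∃ η : ℝ, 0 < η ∧ η ≤ 1 / 2 ∧ η ≤ ε / 16 :=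
    ⟨min (1 / 2) (ε / 16), by positivity, min_le_left _ _, min_le_right _ _⟩
  obtain ⟨B, hB, hwtail⟩ := hwfield.exists_sharp_tail_bound hwcont hσpos hub hη (by linarith)
  set m := (1 + 2 * η) ^ 2 * L + 1 with hm
  obtain ⟨ρ, hρ, hρf, hρh⟩ : ∃ ρ : ℝ, 0 < ρ ∧ m ≤ cf * ρ ^ 2 ∧ m ≤ ch * ρ ^ 2 := by
    refine ⟨√(m / min cf ch), by positivity, ?_, ?_⟩ <;>
      rw [Real.sq_sqrt (by positivity), ← mul_div_assoc, le_div_iff₀ (by positivity), mul_comm] <;>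
      gcongr
    exacts [min_le_left _ _, min_le_right _ _]
  set B' := 2 * A + B + 1 with hB'
  set G := K * n ^ 2 + 2 * n
  set S := 1 + 1 / η + 4 * A / b + (|Real.log (b / 2)| + |Real.log B'|) * (2 / (L * ε))
    + n * ρ + G * ρ ^ 2 / η with hS
  have hS1 : 0 ≤ 1 / η := by positivity
  have hS2 : 0 ≤ 4 * A / b := by positivity
  have hS3 : 0 ≤ |Real.log (b / 2)| * (2 / (L * ε)) := by positivity
  have hS4 : 0 ≤ |Real.log B'| * (2 / (L * ε)) := by positivity
  have hS5 : 0 ≤ n * ρ := by positivity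
  have hS6 : 0 ≤ G * ρ ^ 2 / η := by positivity
  have hS0 : 0 < S := by rw [hS, add_mul]; linarith
  refine ⟨1 / S, by positivity, fun a u ha hu huδ htδ => ?_⟩
  rw [one_div_one_div] at htδ
  have huS : u * S < 1 := by rwa [lt_div_iff₀ hS0] at huδ
  obtain ⟨t, ht⟩ : ∃ t, t = u / a := ⟨_, rfl⟩
  have hat : a * t = u := by rw [ht]; field_simp
  rw [← ht, hS, add_mul] at htδ
  have ht1 : 1 < t := by linarith
  have htt : t ≤ t ^ 2 := by nlinarith
  have hR : n * (a * (ρ * t)) ≤ 1 := by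
    have : n * (a * (ρ * t)) = u * (n * ρ) := by rw [← hat]; ring
    rw [this]
    refine le_trans ?_ huS.le
    gcongr
    rw [hS, add_mul]; linarith
  have hlin : G * (a * (ρ * t)) ^ 2 ≤ η * u := by
    have h1 : G * (a * (ρ * t)) ^ 2 = η * (u * (u * (G * ρ ^ 2 / η))) := by
      rw [← hat]; field_simp
    have h2 : u * (G * ρ ^ 2 / η) ≤ 1 := by
      refine le_trans ?_ huS.le
      gcongr
      rw [hS, add_mul]; linarith
    rw [h1]
    gcongr
    exact mul_le_of_le_one_right hu.le h2
  have hN : 0 < L * t ^ 2 := by positivity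
  have hden : -u ^ 2 / (2 * a ^ 2 * σwsq) = -(L * t ^ 2) := by
    rw [hL, ht]; field_simp
  have hlog {y : ℝ} (hy : |y| * (2 / (L * ε)) < t) : |y| < ε / 2 * (L * t ^ 2) := by
    have h1 := hy.trans_le htt
    rw [mul_div_assoc', div_lt_iff₀ (by positivity)] at h1
    linarith
  set Ef := {ω | ∃ x, ρ * t < |f (ω, x)|}
  set Eh := {ω | ∃ x, ρ * t < |h (ω, x)|}
  set D := {ω | u < ⨆ x, |bransonCurvatureChange n a (Q₀ x) (f (ω, x)) (h (ω, x))|} with hD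
  have hEbound {c : ℝ} (hc : m ≤ c * ρ ^ 2) :
      A * rexp (-(c * (ρ * t) ^ 2)) ≤ A * rexp (-(m * t ^ 2)) := by
    rw [mul_pow, ← mul_assoc]
    gcongr
  have hEf : P.real Ef ≤ A * rexp (-(m * t ^ 2)) :=
    (hftail _ (by positivity)).trans (hEbound hρf)
  have hEh : P.real Eh ≤ A * rexp (-(m * t ^ 2)) :=
    (hhtail _ (by positivity)).trans (hEbound hρh)
  have hgood {ω : Ω} (hωf : ω ∉ Ef) (hωh : ω ∉ Eh) :
      (∀ x, |f (ω, x)| ≤ ρ * t) ∧ ∀ x, |h (ω, x)| ≤ ρ * t :=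
    ⟨fun x => not_lt.1 fun hx => hωf ⟨x, hx⟩, fun x => not_lt.1 fun hx => hωh ⟨x, hx⟩⟩
  have hupper : P.real D ≤ P.real Ef + P.real Eh + P.real {ω | ∃ x, (1 - η) * t < |w x ω|} := by
    have hsub : D ⊆ Ef ∪ Eh ∪ {ω | ∃ x, (1 - η) * t < |w x ω|} := by
      intro ω hω
      by_cases hωf : ω ∈ Ef
      · exact .inl (.inl hωf)
      by_cases hωh : ω ∈ Eh
      · exact .inl (.inr hωh)
      obtain ⟨h1, h2⟩ := hgood hωf hωh
      have := exists_lt_abs_linearization hn0.le ha hK h1 h2 hR hlin hω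
      rw [← ht] at this
      exact .inr this
    refine (measureReal_mono hsub).trans ((measureReal_union_le _ _).trans ?_)
    gcongr
    exact measureReal_union_le _ _
  have hlower' : P.real {ω | (1 + η) * t < w x₀ ω} ≤ P.real Ef + P.real Eh + P.real D := by
    have hsub : {ω | (1 + η) * t < w x₀ ω} ⊆ Ef ∪ Eh ∪ D := by
      intro ω hω
      by_cases hωf : ω ∈ Ef
      · exact .inl (.inl hωf)
      by_cases hωh : ω ∈ Eh
      · exact .inl (.inr hωh)
      obtain ⟨h1, h2⟩ := hgood hωf hωh
      rw [ht] at hω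
      exact .inr (lt_iSup_abs_bransonCurvatureChange hn0.le ha hK h1 h2 (ht ▸ hR) (ht ▸ hlin) hω)
    refine (measureReal_mono hsub).trans ((measureReal_union_le _ _).trans ?_)
    gcongr
    exact measureReal_union_le _ _
  rw [hden]
  refine log_div_neg_mem_Ioo (p := P.real D) (b := b / 2) (B := B') hN (by positivity)
    (by positivity) (hlog (by linarith)) (hlog (by linarith)) ?_ ?_
  · have h1 := hlower ((1 + η) * t) (by positivity)
    have h2 := le_sub_two_mul_exp (ε := ε) hb hσpos hη hη1 hηε ht1.le (by linarith)
      (by linarith : 4 * A / b ≤ t)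
    rw [← hL, ← hm] at h2
    linarith
  · have h1 := hwtail ((1 - η) * t) (mul_nonneg (by linarith) (by linarith))
    have h2 := two_mul_add_exp_le (t := t) hA hB hσpos hη hη1 hηε
    rw [← hL, ← hm, ← hB'] at h2
    linarith
end
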